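/- arXiv:quant-ph/0510197 — 2 statements merged into one kernel-verified Lean document; each statement's English description precedes it below -/
import Mathlib

section
/- Let A_Z, A_AB, A_BC, A_B be finite-dimensional factors satisfying the commuting square condition and let ψ be a faithful state on A_Z. Define T^♯(X) := ρ_{ψ_BC}^{1/2} ρ_{ψ_B}^{−1/2} X ρ_{ψ_B}^{−1/2} ρ_{ψ_BC}^{1/2}. Then the strong additivity of von Neumann entropy S(ψ) − S(ψ|_{A_AB}) − S(ψ|_{A_BC}) + S(ψ|_{A_B}) = 0 holds if and only if the conditional expectation E_AB is sufficient for the pair of states ψ and ψ ∘ E_BC, which holds if and only if T^♯(ρ_{ψ_AB}) = ρ_{ψ_Z}. -/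
open scoped ComplexOrder

/-- The full matrix algebra `M_N(ℂ)`, our model of a finite-dimensional factor. -/
abbrev Mat (N : ℕ) := Matrix (Fin N) (Fin N) ℂ

variable {N : ℕ}

/-- The tracial state `τ` on `Mat N`. -/
noncomputable def tau (x : Mat N) : ℂ := x.trace / N

/-- Matrix logarithm via the continuous functional calculus. -/
noncomputable def mlog (x : Mat N) : Mat N := cfc Real.log x

/-- Matrix square root via the continuous functional calculus. -/
noncomputable def msqrt (x : Mat N) : Mat N := cfc Real.sqrt x

/-- Matrix inverse square root via the continuous functional calculus. -/
noncomputable def misqrt (x : Mat N) : Mat N := cfc (fun t : ℝ => (Real.sqrt t)⁻¹) x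

/-- The entropy `Ŝ(ψ) = -ψ(log ρ_ψ) = -τ(ρ log ρ)` of the state with τ-density `ρ`. -/
noncomputable def Shat (ρ : Mat N) : ℝ := -(tau (ρ * mlog ρ)).re

/-- The von Neumann entropy `S(ψ|_B) = -Tr_B(D log D) = Ŝ(ψ|_B) + log k` of the
restriction of a state to a subfactor `B ≅ M_k`, expressed through the τ-density `ρ`
of the restriction and the matrix size `k` of the subfactor. -/
noncomputable def Sres (ρ : Mat N) (k : ℕ) : ℝ := Shat ρ + Real.log k

/-- `ρ` is the density with respect to the tracial state `τ` of a state of `Mat N`. -/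
def IsTauDensity (ρ : Mat N) : Prop := ρ.PosSemidef ∧ tau ρ = 1

/-- `E` is the τ-preserving conditional expectation onto the unital *-subalgebra `B`:
it maps into `B`, fixes `B` pointwise, and `Tr(b x) = Tr(b (E x))` for all `b ∈ B`.
These properties determine `E` uniquely. -/
def IsCondExp (B : StarSubalgebra ℂ (Mat N)) (E : Mat N →ₗ[ℂ] Mat N) : Prop :=
  (∀ x, E x ∈ B) ∧ (∀ b ∈ B, E b = b) ∧
    (∀ x : Mat N, ∀ b ∈ B, (b * x).trace = (b * E x).trace)

/-- `B` is a subfactor: its relative center is trivial (so `B` is a full matrix algebra). -/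
def IsFactorSub (B : StarSubalgebra ℂ (Mat N)) : Prop :=
  ∀ x ∈ B, (∀ y ∈ B, x * y = y * x) → ∃ c : ℂ, x = c • (1 : Mat N)

/-- The commuting square condition: `B = AB ⊓ BC` and `E_AB ∘ E_BC = E_BC ∘ E_AB = E_B`. -/
def CommSquare (AB BC B : StarSubalgebra ℂ (Mat N))
    (EAB EBC EB : Mat N →ₗ[ℂ] Mat N) : Prop :=
  IsCondExp AB EAB ∧ IsCondExp BC EBC ∧ IsCondExp B EB ∧
    B = AB ⊓ BC ∧ (∀ x, EAB (EBC x) = EB x) ∧ (∀ x, EBC (EAB x) = EB x)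

open Classical in
/-- Relative entropy `H(ρ₁, ρ₂) = τ(ρ₁ (log ρ₁ - log ρ₂))` of two τ-densities, equal to `+∞`
unless the support of `ρ₁` is dominated by the support of `ρ₂` (for positive semidefinite
matrices the support condition is the inclusion of kernels `ker ρ₂ ⊆ ker ρ₁`). -/
noncomputable def relEnt (ρ₁ ρ₂ : Mat N) : EReal :=
  if ∀ v : Fin N → ℂ, ρ₂.mulVec v = 0 → ρ₁.mulVec v = 0 then
    (((tau (ρ₁ * (mlog ρ₁ - mlog ρ₂))).re : ℝ) : EReal)
  else ⊤

/-- Complete positivity of a linear map on `Mat N`. -/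
def IsCP (E : Mat N →ₗ[ℂ] Mat N) : Prop :=
  ∀ (k : ℕ) (x a : Fin k → Mat N),
    (∑ i, ∑ j, star (a i) * E (star (x i) * x j) * a j).PosSemidef

/-- `p` is a minimal projection of the subalgebra `B`. -/
def IsMinProj (B : StarSubalgebra ℂ (Mat N)) (p : Mat N) : Prop :=
  p ∈ B ∧ p.IsHermitian ∧ p * p = p ∧ p ≠ 0 ∧
    ∀ q ∈ B, q.IsHermitian → q * q = q → q * p = q → q = 0 ∨ q = p

/-- The subfactor `B` of `Mat N` has matrix size `k` (i.e. `B ≅ M_k`) in the sense that its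
minimal projections have ambient matrix trace `N / k`; this encodes the assumption that the
ambient matrix trace restricts on `B` to `N/k` times the canonical matrix trace of `B`. -/
def HasMatSize (B : StarSubalgebra ℂ (Mat N)) (k : ℕ) : Prop :=
  ∀ p, IsMinProj B p → Matrix.trace p = ((N : ℂ) / k)

/-- `Θ` is a grading: an involutive *-automorphism. -/
def IsGrading (Θ : Mat N ≃⋆ₐ[ℂ] Mat N) : Prop := ∀ x, Θ (Θ x) = x

/-- The subalgebra `A` is invariant under the grading. -/
def ThetaInvariant (Θ : Mat N ≃⋆ₐ[ℂ] Mat N) (A : StarSubalgebra ℂ (Mat N)) : Prop :=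
  ∀ x ∈ A, Θ x ∈ A

/-- Graded commutation relations between (the subalgebras of) two disjoint regions:
even elements of one commute with all elements of the other, odd elements anticommute. -/
def GradedComm (Θ : Mat N ≃⋆ₐ[ℂ] Mat N) (A C : StarSubalgebra ℂ (Mat N)) : Prop :=
  ∀ x ∈ A, ∀ y ∈ C,
    ((Θ x = x ∨ Θ y = y) → x * y = y * x) ∧
      (Θ x = -x → Θ y = -y → x * y + y * x = 0)

/-- `ω` is a state (positive normalized linear functional). -/
def IsState (ω : Mat N →ₗ[ℂ] ℂ) : Prop :=
  ω 1 = 1 ∧ ∀ x : Mat N, 0 ≤ ω (star x * x)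

/-- Markov property of the state `ω` with respect to a triplet with first algebra `AA` and
pair algebra `AB`: there is a quasi-conditional expectation (a completely positive map into
`AB` which is a module map over `AA`) fixing `AA` pointwise and preserving `ω`. -/
def IsMarkovState (AA AB : StarSubalgebra ℂ (Mat N)) (ω : Mat N →ₗ[ℂ] ℂ) : Prop :=
  ∃ E : Mat N →ₗ[ℂ] Mat N, IsCP E ∧ (∀ x, E x ∈ AB) ∧
    (∀ c ∈ AA, ∀ x, E (c * x) = c * E x) ∧ (∀ c ∈ AA, E c = c) ∧
    ∀ x, ω (E x) = ω x

/-- Markov property, formulated for the state with τ-density `ρ`. -/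
def IsMarkovDensity (AA AB : StarSubalgebra ℂ (Mat N)) (ρ : Mat N) : Prop :=
  ∃ E : Mat N →ₗ[ℂ] Mat N, IsCP E ∧ (∀ x, E x ∈ AB) ∧
    (∀ c ∈ AA, ∀ x, E (c * x) = c * E x) ∧ (∀ c ∈ AA, E c = c) ∧
    ∀ x, tau (ρ * E x) = tau (ρ * x)

/-- The restriction of `ω` to the subalgebra generated by `AA` and `AC` is separable:
a convex combination of product states for the pair `(AA, AC)`. -/
def SeparableOn (AA AC : StarSubalgebra ℂ (Mat N)) (ω : Mat N →ₗ[ℂ] ℂ) : Prop :=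
  ∃ (n : ℕ) (lam : Fin n → ℝ) (ωi : Fin n → (Mat N →ₗ[ℂ] ℂ)),
    (∀ i, 0 ≤ lam i) ∧ (∑ i, lam i = 1) ∧ (∀ i, IsState (ωi i)) ∧
    (∀ i, ∀ x ∈ AA, ∀ y ∈ AC, ωi i (x * y) = ωi i x * ωi i y) ∧
    ∀ z ∈ (AA ⊔ AC : StarSubalgebra ℂ (Mat N)), ω z = ∑ i, (lam i : ℂ) * ωi i z

/-- The conditional expectation `E` is sufficient for the pair of states with τ-densities
`ρ₁, ρ₂`: some completely positive trace-preserving (recovery) map `T` recovers the densities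
from their compressions `E ρ₁`, `E ρ₂` (recall that the τ-density of `ψ ∘ E` is `E ρ_ψ`). -/
def IsSufficient (E : Mat N →ₗ[ℂ] Mat N) (ρ₁ ρ₂ : Mat N) : Prop :=
  ∃ T : Mat N →ₗ[ℂ] Mat N, IsCP T ∧ (∀ x, (T x).trace = x.trace) ∧
    T (E ρ₁) = ρ₁ ∧ T (E ρ₂) = ρ₂

section Spectral

open scoped Matrix

variable {n : Type*} [Fintype n] [DecidableEq n]

/-- Spectral decomposition of a Hermitian matrix into trace-one positive pieces. -/
theorem exists_spectral_decomposition {A : Matrix n n ℂ} (hA : A.IsHermitian) :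
    ∃ P : n → Matrix n n ℂ, (∀ i, (P i).trace = 1) ∧ (∑ i, P i = 1) ∧
      (∀ i, A * P i = hA.eigenvalues i • P i) ∧ (∀ i, P i * A = hA.eigenvalues i • P i) ∧
      ∀ f : ℝ → ℝ, cfc f A = ∑ i, f (hA.eigenvalues i) • P i := by
  set U : Matrix n n ℂ := (hA.eigenvectorUnitary : Matrix n n ℂ) with hU
  have hUU : star U * U = 1 := Unitary.coe_star_mul_self hA.eigenvectorUnitary
  have hUU' : U * star U = 1 := Unitary.coe_mul_star_self hA.eigenvectorUnitary
  have hcfc (f : ℝ → ℝ) : cfc f A =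
      ∑ i, f (hA.eigenvalues i) • (U * Matrix.single i i (1 : ℂ) * star U) := by
    have h : Matrix.diagonal (RCLike.ofReal ∘ f ∘ hA.eigenvalues) =
        ∑ i, f (hA.eigenvalues i) • Matrix.single i i (1 : ℂ) := by
      rw [← Matrix.sum_single_eq_diagonal]
      refine Finset.sum_congr rfl fun i _ => ?_
      rw [Matrix.smul_single]
      simp
    rw [hA.cfc_eq, Matrix.IsHermitian.cfc, Unitary.conjStarAlgAut_apply, h]
    simp only [Finset.mul_sum, Finset.sum_mul, hU, Matrix.mul_smul, Matrix.smul_mul]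
  have hid : A = ∑ i, hA.eigenvalues i • (U * Matrix.single i i (1 : ℂ) * star U) := by
    conv_lhs => rw [← cfc_id ℝ A hA]
    exact hcfc _
  have hmul (i j : n) : (U * Matrix.single i i (1 : ℂ) * star U) *
      (U * Matrix.single j j (1 : ℂ) * star U) =
      if i = j then U * Matrix.single i i (1 : ℂ) * star U else 0 := by
    calc _ = U * Matrix.single i i (1 : ℂ) * (star U * U) * Matrix.single j j (1 : ℂ) * star U := by
          simp only [mul_assoc]
      _ = _ := by
          rw [hUU, mul_one, mul_assoc U]
          split_ifs with h
          · subst h; simp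
          · simp [Matrix.single_mul_single_of_ne, h]
  refine ⟨fun i => U * Matrix.single i i (1 : ℂ) * star U, fun i => ?_, ?_, fun i => ?_,
    fun i => ?_, hcfc⟩
  · rw [Matrix.trace_mul_comm, ← mul_assoc, hUU, one_mul]
    simp
  · rw [← Finset.sum_mul, ← Finset.mul_sum, Matrix.sum_single_eq_diagonal]
    simpa using hUU'
  · conv_lhs => rw [hid]
    simp [Finset.sum_mul, hmul]
  · conv_lhs => rw [hid]
    simp [Finset.mul_sum, hmul]

theorem cfc_mul_cfc (A : Matrix n n ℂ) (f g : ℝ → ℝ) :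
    cfc f A * cfc g A = cfc (fun t => f t * g t) A :=
  (cfc_mul f g A (Matrix.finite_real_spectrum.continuousOn f)
    (Matrix.finite_real_spectrum.continuousOn g)).symm

theorem cfc_mem_starSubalgebra (B : StarSubalgebra ℂ (Matrix n n ℂ)) {A : Matrix n n ℂ}
    (hA : A ∈ B) (f : ℝ → ℝ) : cfc f A ∈ B := by
  have : IsClosed (B : Set (Matrix n n ℂ)) :=
    Submodule.closed_of_finiteDimensional (Subalgebra.toSubmodule B.toSubalgebra)
  exact cfc_mem f hA

/-- A Hermitian element of a star subalgebra that pairs nonnegatively with every positive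
semidefinite element of that subalgebra is positive semidefinite. -/
theorem posSemidef_of_trace_mul_nonneg (B : StarSubalgebra ℂ (Matrix n n ℂ)) {A : Matrix n n ℂ}
    (hA : A.IsHermitian) (hAB : A ∈ B)
    (h : ∀ b ∈ B, b.PosSemidef → 0 ≤ (b * A).trace.re) : A.PosSemidef := by
  obtain ⟨P, htr, -, -, hPA, hcfc⟩ := exists_spectral_decomposition hA
  rw [hA.posSemidef_iff_eigenvalues_nonneg]
  have hneg : (cfc (fun t : ℝ => max (-t) 0) A).PosSemidef := by
    have : IsSelfAdjoint (cfc (fun t : ℝ => √(max (-t) 0)) A) := cfc_predicate _ _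
    have h2 : cfc (fun t : ℝ => max (-t) 0) A = (cfc (fun t : ℝ => √(max (-t) 0)) A)ᴴ *
        cfc (fun t : ℝ => √(max (-t) 0)) A := by
      rw [← Matrix.star_eq_conjTranspose, this.star_eq, cfc_mul_cfc]
      simp
    rw [h2]
    exact Matrix.posSemidef_conjTranspose_mul_self _
  have h1 := h _ (cfc_mem_starSubalgebra B hAB _) hneg
  rw [hcfc] at h1
  simp only [Finset.sum_mul, smul_mul_assoc, hPA, Matrix.trace_sum, Matrix.trace_smul, htr,
    Complex.re_sum, Complex.real_smul, mul_one, ← Complex.ofReal_mul, Complex.ofReal_re] at h1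
  have hle : ∀ i ∈ Finset.univ, max (-hA.eigenvalues i) 0 * hA.eigenvalues i ≤ 0 := by
    intro i _
    rcases le_total (hA.eigenvalues i) 0 with h | h
    · exact mul_nonpos_of_nonneg_of_nonpos (le_max_right _ _) h
    · rw [max_eq_right (by linarith)]; simp
  have h0 := (Finset.sum_eq_zero_iff_of_nonpos hle).1 (le_antisymm (Finset.sum_nonpos hle) h1)
  intro i
  by_contra! hi
  have := h0 i (Finset.mem_univ i)
  rw [max_eq_left (by simp at hi; linarith)] at this
  simp at hi
  nlinarith

end Spectral

section RealAnalysis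

variable {ι : Type*} [Fintype ι]

theorem sum_smul_eq_zero_of_sum_resolvent_eq_zero {lam : ι → ℝ} {v : ι → ℂ}
    (hlam : ∀ i, 0 < lam i) (h : ∀ t : ℝ, 0 < t → ∑ i, (lam i + t)⁻¹ • v i = 0) (f : ℝ → ℝ) :
    ∑ i, f (lam i) • v i = 0 := by
  classical
  have hfib (g : ℝ → ℝ) : ∑ i, g (lam i) • v i =
      ∑ μ ∈ Finset.univ.image lam, g μ • ∑ i with lam i = μ, v i := by
    rw [← Finset.sum_fiberwise_of_maps_to (g := lam) (t := Finset.univ.image lam) (by simp)]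
    refine Finset.sum_congr rfl fun μ _ => ?_
    rw [Finset.smul_sum]
    exact Finset.sum_congr rfl fun i hi => by rw [(Finset.mem_filter.1 hi).2]
  set w : ℝ → ℂ := fun μ => ∑ i with lam i = μ, v i with hw
  set S := Finset.univ.image lam with hS
  have hSpos : ∀ μ ∈ S, 0 < μ := by simp [hS, hlam]
  let p : Polynomial ℂ := ∑ μ ∈ S, Polynomial.C (w μ) *
    ∏ ν ∈ S.erase μ, (Polynomial.X + Polynomial.C (ν : ℂ))
  have hp : p = 0 := by
    refine Polynomial.eq_zero_of_infinite_isRoot _ (Set.Infinite.mono (s := (fun t : ℝ => (t : ℂ)) ''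
      Set.Ioi 0) ?_ ((Set.Ioi_infinite 0).image Complex.ofReal_injective.injOn))
    rintro _ ⟨t, ht, rfl⟩
    have ht' : 0 < t := ht
    have h1 := h t ht'
    rw [hfib (fun x => (x + t)⁻¹)] at h1
    have h2 : p.eval (t : ℂ) = (∏ ν ∈ S, ((t : ℂ) + ν)) * ∑ μ ∈ S, (μ + t)⁻¹ • w μ := by
      simp only [p, Polynomial.eval_finsetSum, Polynomial.eval_mul, Polynomial.eval_C,
        Polynomial.eval_prod, Polynomial.eval_add, Polynomial.eval_X, Finset.mul_sum]
      refine Finset.sum_congr rfl fun μ hμ => ?_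
      rw [← Finset.mul_prod_erase _ _ hμ, Complex.real_smul]
      have : (t : ℂ) + μ ≠ 0 := by
        have := hSpos μ hμ
        exact_mod_cast (by positivity : t + μ ≠ 0)
      push_cast
      rw [add_comm (μ : ℂ)]
      field_simp
    show p.eval _ = 0
    rw [h2, h1, mul_zero]
  have hw0 : ∀ μ ∈ S, w μ = 0 := by
    intro μ hμ
    have h1 : p.eval (-(μ : ℂ)) = 0 := by rw [hp]; simp
    simp only [p, Polynomial.eval_finsetSum, Polynomial.eval_mul, Polynomial.eval_C,
        Polynomial.eval_prod, Polynomial.eval_add, Polynomial.eval_X] at h1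
    rw [Finset.sum_eq_single_of_mem μ hμ] at h1
    · refine (mul_eq_zero.1 h1).resolve_right (Finset.prod_ne_zero_iff.2 fun ν hν hz => ?_)
      refine (Finset.mem_erase.1 hν).1 ?_
      have : (ν : ℂ) = μ := by linear_combination hz
      exact_mod_cast this
    · intro ν _ hne
      rw [Finset.prod_eq_zero (i := μ) (Finset.mem_erase.2 ⟨hne.symm, hμ⟩) (by simp), mul_zero]
  rw [hfib]
  exact Finset.sum_eq_zero fun μ hμ => by simp only [hw] at hw0; rw [hw0 μ hμ, smul_zero]

open Filter Topology in
theorem sum_resolvent_eq_zero_of_sum_log_eq_zero {lam α : ι → ℝ} (hlam : ∀ i, 0 < lam i)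
    (hα : ∑ i, α i = 0) (hlog : ∑ i, Real.log (lam i) * α i = 0)
    (hnonneg : ∀ t : ℝ, 0 < t → 0 ≤ ∑ i, (lam i + t)⁻¹ * α i) {t : ℝ} (ht : 0 < t) :
    ∑ i, (lam i + t)⁻¹ * α i = 0 := by
  set F : ℝ → ℝ := fun t => ∑ i, Real.log (lam i + t) * α i with hF
  have hd (t : ℝ) (ht : 0 ≤ t) : HasDerivAt F (∑ i, (lam i + t)⁻¹ * α i) t := by
    refine HasDerivAt.fun_sum fun i _ => ?_
    have hi := hlam i
    have := ((hasDerivAt_id t).const_add (lam i)).log (by simp; positivity)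
    simpa using this.mul_const (α i)
  have hmono : MonotoneOn F (Set.Ici 0) := by
    refine monotoneOn_of_deriv_nonneg (convex_Ici 0)
      (fun t ht => (hd t ht).continuousAt.continuousWithinAt) ?_ ?_
    · intro t ht
      rw [interior_Ici] at ht
      exact (hd t ht.le).differentiableAt.differentiableWithinAt
    · intro t ht
      rw [interior_Ici] at ht
      rw [(hd t ht.le).deriv]
      exact hnonneg t ht
  have hlim : Tendsto F atTop (𝓝 0) := by
    have h1 : Tendsto (fun t => ∑ i, Real.log (1 + lam i / t) * α i) atTop (𝓝 0) := by
      have : (0 : ℝ) = ∑ i, Real.log (1 + 0) * α i := by simp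
      rw [this]
      refine tendsto_finsetSum _ fun i _ => Tendsto.mul_const _ ?_
      refine Tendsto.log ?_ (by norm_num)
      exact tendsto_const_nhds.add (tendsto_const_nhds.div_atTop tendsto_id)
    refine h1.congr' ?_
    filter_upwards [eventually_gt_atTop 0] with t ht
    have h2 (i : ι) : Real.log (lam i + t) = Real.log (1 + lam i / t) + Real.log t := by
      have hi := hlam i
      rw [← Real.log_mul (by positivity) ht.ne']
      congr 1
      field_simp
      ring
    simp only [hF, h2, add_mul, Finset.sum_add_distrib, ← Finset.mul_sum, hα]
    ring
  have hF0 : F 0 = 0 := by simpa [hF] using hlog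
  have hz (s : ℝ) (hs : 0 < s) : F s = 0 := by
    refine le_antisymm ?_ ?_
    · refine ge_of_tendsto hlim ?_
      filter_upwards [eventually_ge_atTop s] with u hu
      exact hmono hs.le (hs.le.trans hu) hu
    · rw [← hF0]
      exact hmono (Set.mem_Ici.2 le_rfl) hs.le hs.le
  rw [← (hd t ht.le).deriv]
  have : F =ᶠ[𝓝 t] fun _ => 0 := by
    filter_upwards [Ioi_mem_nhds ht] with s hs using hz s hs
  rw [this.deriv_eq]
  simp

end RealAnalysis

section CondExp

open scoped Matrix

theorem eq_zero_of_trace_mul_mul_conjTranspose_nonpos {x : Mat N} (hx : x.PosDef) {D : Mat N}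
    (h : (D * x * Dᴴ).trace.re ≤ 0) : D = 0 := by
  have hpsd := hx.posSemidef.mul_mul_conjTranspose_same D
  have h0 : D * x * Dᴴ = 0 := by
    rw [← hpsd.trace_eq_zero_iff]
    have h1 := Complex.nonneg_iff.1 hpsd.trace_nonneg
    exact Complex.ext (le_antisymm h h1.1) h1.2.symm
  have hD : Dᴴ = 0 := by
    refine Matrix.ext_of_mulVec_single fun j => ?_
    rw [Matrix.zero_mulVec]
    by_contra hne
    have h1 := hx.dotProduct_mulVec_pos hne
    rw [Matrix.star_mulVec, Matrix.conjTranspose_conjTranspose, ← Matrix.dotProduct_mulVec,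
      Matrix.mulVec_mulVec, Matrix.mulVec_mulVec, h0] at h1
    simp at h1
  simpa using congrArg Matrix.conjTranspose hD

/-- Block matrices all of whose blocks lie in `B`. -/
def blockSubalgebra (k : ℕ) (B : StarSubalgebra ℂ (Mat N)) :
    StarSubalgebra ℂ (Matrix (Fin k × Fin N) (Fin k × Fin N) ℂ) where
  carrier := {M | ∀ i j, (Matrix.of fun p q => M (i, p) (j, q)) ∈ B}
  mul_mem' {a b} ha hb i j := by
    have h : (Matrix.of fun p q => (a * b) (i, p) (j, q)) =
        ∑ l, (Matrix.of fun p q => a (i, p) (l, q)) * Matrix.of fun p q => b (l, p) (j, q) := by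
      ext p q
      simp [Matrix.mul_apply, Matrix.sum_apply, Fintype.sum_prod_type]
    rw [h]
    exact sum_mem fun l _ => mul_mem (ha i l) (hb l j)
  add_mem' {a b} ha hb i j := add_mem (ha i j) (hb i j)
  algebraMap_mem' c i j := by
    by_cases h : i = j
    · convert algebraMap_mem B c using 1
      ext p q
      simp [Matrix.algebraMap_matrix_apply, h]
    · convert zero_mem B using 1
      ext p q
      simp [Matrix.algebraMap_matrix_apply, h]
  star_mem' {a} ha i j := by
    exact star_mem (ha j i)

variable {B : StarSubalgebra ℂ (Mat N)} {E : Mat N →ₗ[ℂ] Mat N}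

theorem eq_zero_of_trace_mul_eq_zero {a : Mat N} (ha : a ∈ B)
    (h : ∀ b ∈ B, (b * a).trace = 0) : a = 0 :=
  Matrix.trace_conjTranspose_mul_self_eq_zero_iff.1 (h _ (star_mem ha))

theorem eq_of_trace_mul_eq {a a' : Mat N} (ha : a ∈ B) (ha' : a' ∈ B)
    (h : ∀ b ∈ B, (b * a).trace = (b * a').trace) : a = a' := by
  refine sub_eq_zero.1 (eq_zero_of_trace_mul_eq_zero (sub_mem ha ha') fun b hb => ?_)
  rw [mul_sub, Matrix.trace_sub, h b hb, sub_self]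

namespace IsCondExp

theorem map_mul_left (hE : IsCondExp B E) {b : Mat N} (hb : b ∈ B) (x : Mat N) :
    E (b * x) = b * E x := by
  refine eq_of_trace_mul_eq (hE.1 _) (mul_mem hb (hE.1 _)) fun c hc => ?_
  rw [← hE.2.2 _ c hc, ← mul_assoc, ← mul_assoc, hE.2.2 _ _ (mul_mem hc hb)]

theorem map_mul_right (hE : IsCondExp B E) {b : Mat N} (hb : b ∈ B) (x : Mat N) :
    E (x * b) = E x * b := by
  refine eq_of_trace_mul_eq (hE.1 _) (mul_mem (hE.1 _) hb) fun c hc => ?_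
  rw [← hE.2.2 _ c hc, ← mul_assoc, ← mul_assoc, Matrix.trace_mul_comm, ← mul_assoc,
    hE.2.2 _ _ (mul_mem hb hc), Matrix.trace_mul_comm (c * E x) b, mul_assoc]

theorem map_star (hE : IsCondExp B E) (x : Mat N) : E (star x) = star (E x) := by
  refine eq_of_trace_mul_eq (hE.1 _) (star_mem (hE.1 _)) fun c hc => ?_
  rw [← hE.2.2 _ c hc]
  have h := congrArg star (hE.2.2 x _ (star_mem hc))
  simp only [← Matrix.trace_conjTranspose, ← Matrix.star_eq_conjTranspose, star_mul,
    star_star] at h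
  rw [Matrix.trace_mul_comm, h, Matrix.trace_mul_comm]

theorem trace_map (hE : IsCondExp B E) (x : Mat N) : (E x).trace = x.trace := by
  have := hE.2.2 x 1 (one_mem B)
  simpa using this.symm

theorem isHermitian_map (hE : IsCondExp B E) {x : Mat N} (hx : x.IsHermitian) :
    (E x).IsHermitian := by
  rw [Matrix.IsHermitian, ← Matrix.star_eq_conjTranspose, ← hE.map_star,
    Matrix.star_eq_conjTranspose, hx.eq]

theorem posDef_map (hE : IsCondExp B E) {x : Mat N} (hx : x.PosDef) : (E x).PosDef := by
  have hH := hE.isHermitian_map hx.1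
  obtain ⟨P, htr, -, -, hPA, hcfc⟩ := exists_spectral_decomposition hH
  rw [hH.posDef_iff_eigenvalues_pos]
  set f : ℝ → ℝ := fun t => if t ≤ 0 then 1 else 0
  set p : Mat N := cfc f (E x) with hp
  have hpp : p * p = p := by
    rw [hp, cfc_mul_cfc]
    congr 1
    ext t
    simp [f]
  have hps : pᴴ = p := (cfc_predicate f (E x) : IsSelfAdjoint _).star_eq
  have htr2 : (p * x).trace = (p * x * pᴴ).trace := by
    rw [hps, Matrix.trace_mul_comm (p * x), ← mul_assoc, hpp]
  have hle : (p * x).trace.re ≤ 0 := by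
    rw [hE.2.2 x p (cfc_mem_starSubalgebra B (hE.1 x) f), hp, hcfc]
    simp only [Finset.sum_mul, smul_mul_assoc, hPA, Matrix.trace_sum, Matrix.trace_smul, htr,
      Complex.re_sum, Complex.real_smul, mul_one, ← Complex.ofReal_mul, Complex.ofReal_re]
    refine Finset.sum_nonpos fun i _ => ?_
    by_cases h : hH.eigenvalues i ≤ 0 <;> simp [f, h]
  have hp0 : p = 0 :=
    eq_zero_of_trace_mul_mul_conjTranspose_nonpos hx (by rwa [← htr2])
  intro i
  by_contra! hi
  have h1 : p.trace.re = ∑ i, f (hH.eigenvalues i) := by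
    rw [hp, hcfc]
    simp [Matrix.trace_sum, htr]
  rw [hp0] at h1
  have hf : ∀ i ∈ Finset.univ, 0 ≤ f (hH.eigenvalues i) := by
    intro i _
    simp only [f]
    split_ifs <;> norm_num
  have h2 := (Finset.sum_eq_zero_iff_of_nonneg hf).1 (by rw [← h1]; simp) i (Finset.mem_univ i)
  simp [f, hi] at h2

theorem isCP (hE : IsCondExp B E) : IsCP E := by
  intro k x a
  set M : Matrix (Fin k × Fin N) (Fin k × Fin N) ℂ :=
    Matrix.of fun u v => E (star (x u.1) * x v.1) u.2 v.2 with hM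
  set A : Matrix (Fin k × Fin N) (Fin N) ℂ := Matrix.of fun u q => a u.1 u.2 q with hA
  set X : Matrix (Fin N) (Fin k × Fin N) ℂ := Matrix.of fun p u => x u.1 p u.2 with hX
  have hMpsd : M.PosSemidef := by
    refine posSemidef_of_trace_mul_nonneg (blockSubalgebra k B) ?_ ?_ fun b hb hbp => ?_
    · ext u v
      have : E (star (x u.1) * x v.1) = star (E (star (x v.1) * x u.1)) := by
        rw [← hE.map_star]; simp
      simp only [hM, Matrix.conjTranspose_apply, Matrix.of_apply]
      rw [this, Matrix.star_apply]
    · intro i j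
      exact hE.1 (star (x i) * x j)
    · have h1 : (b * M).trace = (X * b * Xᴴ).trace := by
        calc (b * M).trace = ∑ i, ∑ j, ((Matrix.of fun p q => b (i, p) (j, q)) *
              E (star (x j) * x i)).trace := by
              simp only [Matrix.trace, Matrix.diag_apply, Matrix.mul_apply, hM, Matrix.of_apply,
                Fintype.sum_prod_type]
              exact Finset.sum_congr rfl fun i _ => Finset.sum_comm
          _ = ∑ i, ∑ j, ((Matrix.of fun p q => b (i, p) (j, q)) * (star (x j) * x i)).trace :=
              Finset.sum_congr rfl fun i _ => Finset.sum_congr rfl fun j _ =>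
                (hE.2.2 _ _ (hb i j)).symm
          _ = (b * (Xᴴ * X)).trace := by
              simp only [Matrix.trace, Matrix.diag_apply, Matrix.mul_apply, hX, Matrix.of_apply,
                Fintype.sum_prod_type, Matrix.conjTranspose_apply, Matrix.star_apply]
              exact Finset.sum_congr rfl fun i _ => Finset.sum_comm
          _ = _ := by rw [← Matrix.mul_assoc, Matrix.trace_mul_comm, ← Matrix.mul_assoc]
      rw [h1]
      exact (Complex.nonneg_iff.1 (hbp.mul_mul_conjTranspose_same X).trace_nonneg).1
  have hsum : ∑ i, ∑ j, star (a i) * E (star (x i) * x j) * a j = Aᴴ * M * A := by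
    rw [Finset.sum_comm]
    ext p q
    simp only [Matrix.sum_apply, Matrix.mul_apply, hA, hM, Matrix.of_apply,
      Fintype.sum_prod_type, Matrix.conjTranspose_apply, Matrix.star_apply, Finset.sum_mul]
    refine Finset.sum_congr rfl fun i _ => ?_
    rw [Finset.sum_comm]
  rw [hsum]
  exact hMpsd.conjTranspose_mul_mul_same A

end IsCondExp

end CondExp

section RelativeModular

open scoped Matrix

/-- Spectral data of the relative modular operator `X ↦ σ X ρ⁻¹` applied to the identity. -/
theorem exists_relative_modular_decomposition {ρ σ : Mat N} (hρ : ρ.PosDef) (hσ : σ.PosDef) :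
    ∃ (lam : Fin N × Fin N → ℝ) (R : Fin N × Fin N → Mat N), (∀ k, 0 < lam k) ∧
      (∀ t : ℝ, 0 < t → σ * (∑ k, (lam k + t)⁻¹ • R k) + t • ((∑ k, (lam k + t)⁻¹ • R k) * ρ) = ρ) ∧
      ∑ k, √(lam k) • R k = msqrt σ * misqrt ρ ∧
      ∑ k, Real.log (lam k) • R k = mlog σ - mlog ρ ∧ ∑ k, R k = 1 := by
  obtain ⟨P, -, hP1, hσP, -, hcσ⟩ := exists_spectral_decomposition hσ.1
  obtain ⟨Q, -, hQ1, -, hQρ, hcρ⟩ := exists_spectral_decomposition hρ.1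
  have hp := hσ.eigenvalues_pos
  have hq := hρ.eigenvalues_pos
  set p := hσ.1.eigenvalues
  set q := hρ.1.eigenvalues
  have hρQ : ρ = ∑ k : Fin N × Fin N, q k.2 • (P k.1 * Q k.2) := by
    have hid : cfc id ρ = ρ := cfc_id ℝ ρ hρ.1
    conv_lhs => rw [← hid, hcρ, ← one_mul (∑ i, _), ← hP1]
    simp only [Finset.sum_mul_sum, Fintype.sum_prod_type, mul_smul_comm, id]
  refine ⟨fun k => p k.1 / q k.2, fun k => P k.1 * Q k.2, fun k => div_pos (hp _) (hq _), ?_, ?_, ?_,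
    ?_⟩
  · intro t ht
    conv_rhs => rw [hρQ]
    simp only [Finset.mul_sum, Finset.sum_mul, Finset.smul_sum, ← Finset.sum_add_distrib]
    refine Finset.sum_congr rfl fun k _ => ?_
    rw [mul_smul_comm, smul_mul_assoc, ← mul_assoc, hσP, mul_assoc, hQρ, smul_mul_assoc,
      mul_smul_comm, smul_smul, smul_smul, smul_smul, ← add_smul]
    congr 1
    have h1 := hp k.1
    have h2 := hq k.2
    field_simp
  · rw [msqrt, misqrt, hcσ, hcρ]
    simp only [Finset.sum_mul_sum, Fintype.sum_prod_type, mul_smul_comm, smul_mul_assoc, smul_smul]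
    refine Finset.sum_congr rfl fun i _ => Finset.sum_congr rfl fun j _ => ?_
    rw [Real.sqrt_div (hp i).le, div_eq_inv_mul]
  · rw [mlog, mlog, hcσ, hcρ, ← mul_one (∑ i, Real.log (p i) • P i), ← hQ1,
      ← one_mul (∑ i, Real.log (q i) • Q i), ← hP1]
    simp only [Finset.sum_mul_sum, Fintype.sum_prod_type, mul_smul_comm, smul_mul_assoc,
      ← Finset.sum_sub_distrib, ← sub_smul]
    refine Finset.sum_congr rfl fun i _ => Finset.sum_congr rfl fun j _ => ?_
    rw [Real.log_div (hp i).ne' (hq j).ne']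
  · rw [Fintype.sum_prod_type, ← Finset.sum_mul_sum, hP1, hQ1, one_mul]

theorem sum_smul_eq_of_sum_resolvent_eq {ι : Type*} [Fintype ι] {lam lam' : ι → ℝ}
    {R R' : ι → Mat N} (hlam : ∀ k, 0 < lam k) (hlam' : ∀ k, 0 < lam' k)
    (h : ∀ t : ℝ, 0 < t → ∑ k, (lam k + t)⁻¹ • R k = ∑ k, (lam' k + t)⁻¹ • R' k) (f : ℝ → ℝ) :
    ∑ k, f (lam k) • R k = ∑ k, f (lam' k) • R' k := by
  ext i j
  have := sum_smul_eq_zero_of_sum_resolvent_eq_zero (lam := Sum.elim lam lam')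
    (v := Sum.elim (fun k => R k i j) (fun k => -R' k i j)) (by simp [hlam, hlam']) (fun t ht => by
      have h1 := congrFun₂ (h t ht) i j
      simp only [Matrix.sum_apply, Matrix.smul_apply] at h1
      simp only [Fintype.sum_sum_type, Sum.elim_inl, Sum.elim_inr, smul_neg, h1,
        Finset.sum_neg_distrib, add_neg_cancel]) f
  simp only [Fintype.sum_sum_type, Sum.elim_inl, Sum.elim_inr, smul_neg, Finset.sum_neg_distrib,
    ← sub_eq_add_neg, sub_eq_zero] at this
  simpa only [Matrix.sum_apply, Matrix.smul_apply] using this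

/-- The concave quadratic form whose maximum is the resolvent quasi-entropy of `(ρ, σ)`. -/
noncomputable def resolventForm (ρ σ : Mat N) (t : ℝ) (X : Mat N) : ℝ :=
  2 * (Xᴴ * ρ).trace.re - (Xᴴ * σ * X).trace.re - t * (X * ρ * Xᴴ).trace.re

theorem resolventForm_sub {ρ σ : Mat N} (hρ : ρ.IsHermitian) (hσ : σ.IsHermitian) {t : ℝ}
    {X₀ : Mat N} (h : σ * X₀ + t • (X₀ * ρ) = ρ) (X : Mat N) :
    resolventForm ρ σ t X₀ - resolventForm ρ σ t X =
      ((X - X₀)ᴴ * σ * (X - X₀)).trace.re + t * ((X - X₀) * ρ * (X - X₀)ᴴ).trace.re := by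
  obtain ⟨D, rfl⟩ : ∃ D, X = X₀ + D := ⟨X - X₀, by abel⟩
  have e1 : (X₀ᴴ * σ * D).trace.re = (Dᴴ * σ * X₀).trace.re := by
    have : X₀ᴴ * σ * D = (Dᴴ * σ * X₀)ᴴ := by
      simp [Matrix.conjTranspose_mul, hσ.eq, mul_assoc]
    rw [this, Matrix.trace_conjTranspose]
    simp
  have e2 : (X₀ * ρ * Dᴴ).trace.re = (Dᴴ * X₀ * ρ).trace.re := by
    rw [Matrix.trace_mul_comm, ← mul_assoc]
  have e3 : (D * ρ * X₀ᴴ).trace.re = (Dᴴ * X₀ * ρ).trace.re := by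
    have : D * ρ * X₀ᴴ = (X₀ * ρ * Dᴴ)ᴴ := by
      simp [Matrix.conjTranspose_mul, hρ.eq, mul_assoc]
    rw [this, Matrix.trace_conjTranspose, ← e2]
    simp
  have e4 : (Dᴴ * ρ).trace.re = (Dᴴ * σ * X₀).trace.re + t * (Dᴴ * X₀ * ρ).trace.re := by
    conv_lhs => rw [← h]
    simp [mul_add, Matrix.trace_add, Matrix.trace_smul, mul_assoc]
  simp only [resolventForm, add_sub_cancel_left, Matrix.conjTranspose_add, mul_add, add_mul,
    Matrix.trace_add, Complex.add_re]
  linear_combination 2 * e4 * (-1) + e1 + t * e2 + t * e3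

theorem resolventForm_le {ρ σ : Mat N} (hρ : ρ.PosDef) (hσ : σ.PosDef) {t : ℝ} (ht : 0 < t)
    {X₀ : Mat N} (h : σ * X₀ + t • (X₀ * ρ) = ρ) (X : Mat N) :
    resolventForm ρ σ t X ≤ resolventForm ρ σ t X₀ := by
  have h1 := resolventForm_sub hρ.1 hσ.1 h X
  have h2 := (Complex.nonneg_iff.1
    (hσ.posSemidef.conjTranspose_mul_mul_same (X - X₀)).trace_nonneg).1
  have h3 := (Complex.nonneg_iff.1
    (hρ.posSemidef.mul_mul_conjTranspose_same (X - X₀)).trace_nonneg).1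
  nlinarith [mul_nonneg ht.le h3]

theorem eq_of_resolventForm_ge {ρ σ : Mat N} (hρ : ρ.PosDef) (hσ : σ.PosDef) {t : ℝ} (ht : 0 < t)
    {X₀ : Mat N} (h : σ * X₀ + t • (X₀ * ρ) = ρ) {X : Mat N}
    (hX : resolventForm ρ σ t X₀ ≤ resolventForm ρ σ t X) : X = X₀ := by
  have h1 := resolventForm_sub hρ.1 hσ.1 h X
  have h2 := (Complex.nonneg_iff.1
    (hσ.posSemidef.conjTranspose_mul_mul_same (X - X₀)).trace_nonneg).1
  refine sub_eq_zero.1 (eq_zero_of_trace_mul_mul_conjTranspose_nonpos hρ ?_)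
  by_contra! h3
  nlinarith [mul_pos ht h3]

theorem resolventForm_eq_trace {ρ σ : Mat N} {t : ℝ}
    {X₀ : Mat N} (h : σ * X₀ + t • (X₀ * ρ) = ρ) :
    resolventForm ρ σ t X₀ = (X₀ᴴ * ρ).trace.re := by
  have e4 : (X₀ᴴ * ρ).trace.re = (X₀ᴴ * σ * X₀).trace.re + t * (X₀ᴴ * X₀ * ρ).trace.re := by
    conv_lhs => rw [← h]
    simp [mul_add, Matrix.trace_add, Matrix.trace_smul, mul_assoc]
  have e2 : (X₀ * ρ * X₀ᴴ).trace.re = (X₀ᴴ * X₀ * ρ).trace.re := by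
    rw [Matrix.trace_mul_comm, ← mul_assoc]
  rw [resolventForm]
  linear_combination e4 - t * e2

theorem resolventForm_condExp {B : StarSubalgebra ℂ (Mat N)} {E : Mat N →ₗ[ℂ] Mat N}
    (hE : IsCondExp B E) (ρ σ : Mat N) (t : ℝ) {Y : Mat N} (hY : Y ∈ B) :
    resolventForm (E ρ) (E σ) t Y = resolventForm ρ σ t Y := by
  have hYs : Yᴴ ∈ B := star_mem hY
  have h1 := hE.2.2 ρ Yᴴ hYs
  have h2 : (Yᴴ * E σ * Y).trace = (Yᴴ * σ * Y).trace := by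
    rw [Matrix.trace_mul_comm, ← mul_assoc, ← hE.2.2 _ _ (mul_mem hY hYs), mul_assoc,
      Matrix.trace_mul_comm Y]
  have h3 : (Y * E ρ * Yᴴ).trace = (Y * ρ * Yᴴ).trace := by
    rw [Matrix.trace_mul_comm, ← mul_assoc, ← hE.2.2 _ _ (mul_mem hYs hY), mul_assoc,
      Matrix.trace_mul_comm Yᴴ]
  rw [resolventForm, resolventForm, h1, h2, h3]

theorem mem_of_resolvent_equation {B : StarSubalgebra ℂ (Mat N)} {E : Mat N →ₗ[ℂ] Mat N}
    (hE : IsCondExp B E) {ρ σ : Mat N} (hρ : ρ.PosDef) (hσ : σ.PosDef) {t : ℝ} (ht : 0 < t)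
    {Y : Mat N} (h : E σ * Y + t • (Y * E ρ) = E ρ) : Y ∈ B := by
  have hEY : E σ * E Y + t • (E Y * E ρ) = E ρ := by
    have h1 := congrArg E h
    rw [map_add, LinearMap.map_smul_of_tower, hE.map_mul_left (hE.1 σ),
      hE.map_mul_right (hE.1 ρ), hE.2.1 _ (hE.1 ρ)] at h1
    exact h1
  have := eq_of_resolventForm_ge (hE.posDef_map hρ) (hE.posDef_map hσ) ht h
    (resolventForm_le (hE.posDef_map hρ) (hE.posDef_map hσ) ht hEY Y)
  exact this ▸ hE.1 Y

end RelativeModular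

section Channel

open scoped Matrix

variable {T : Mat N →ₗ[ℂ] Mat N}

theorem IsCP.map_conjTranspose (hT : IsCP T) (A : Mat N) : T Aᴴ = (T A)ᴴ := by
  have hpos (y : Mat N) : (T (yᴴ * y))ᴴ = T (yᴴ * y) := by
    have := hT 1 (fun _ => y) (fun _ => 1)
    simpa [Matrix.star_eq_conjTranspose] using this.1.eq
  have h1 := hpos (1 + A)
  have h2 := hpos (1 + Complex.I • A)
  have h0 := hpos 1
  have hA := hpos A
  simp only [Matrix.conjTranspose_add, Matrix.conjTranspose_one, Matrix.conjTranspose_smul,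
    mul_add, add_mul, one_mul, mul_one, map_add, smul_mul_smul_comm, map_smul] at h0 h1 h2
  simp only [RCLike.star_def, map_neg, map_one, Complex.conj_I, neg_smul, neg_mul, Complex.I_mul_I, neg_neg, one_smul, hA, h0] at h1 h2
  ext i j
  have e1 := congrFun₂ h1 i j
  have e2 := congrFun₂ h2 i j
  simp only [Matrix.add_apply, Matrix.neg_apply, Matrix.smul_apply, smul_eq_mul] at e1 e2
  linear_combination (-1 / 2) * e1 + (-Complex.I / 2) * e2 +
    (1 / 2) * ((T Aᴴ)ᴴ i j - (T A)ᴴ i j + T Aᴴ i j - T A i j) * Complex.I_sq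

theorem exists_trace_dual (T : Mat N →ₗ[ℂ] Mat N) (X : Mat N) :
    ∃ Y : Mat N, ∀ Z, (Y * Z).trace = (X * T Z).trace := by
  refine ⟨Matrix.of fun i j => (X * T (Matrix.single j i 1)).trace, fun Z => ?_⟩
  conv_rhs => rw [Matrix.matrix_eq_sum_single Z]
  have h (i j : Fin N) : (X * T (Matrix.single i j (Z i j))).trace =
      Z i j * (X * T (Matrix.single i j 1)).trace := by
    have : Matrix.single i j (Z i j) = Z i j • Matrix.single i j (1 : ℂ) := by
      rw [Matrix.smul_single, smul_eq_mul, mul_one]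
    rw [this, map_smul, mul_smul_comm, Matrix.trace_smul, smul_eq_mul]
  simp only [map_sum, Finset.mul_sum, Matrix.trace_sum, h]
  rw [Finset.sum_comm]
  simp [Matrix.trace, Matrix.mul_apply, mul_comm]

open scoped MatrixOrder Matrix.Norms.L2Operator in
theorem exists_conjTranspose_mul_self_eq {Z : Mat N} (hZ : Z.PosSemidef) :
    ∃ S : Mat N, Z = Sᴴ * S :=
  CStarAlgebra.nonneg_iff_eq_star_mul_self.1 hZ.nonneg

/-- Trace form of the Schwarz inequality for the dual of a quantum channel. -/
theorem IsCP.trace_schwarz (hT : IsCP T) (hTtr : ∀ x, (T x).trace = x.trace) {X Y : Mat N}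
    (hY : ∀ Z, (Y * Z).trace = (X * T Z).trace) (hY' : ∀ Z, (Yᴴ * Z).trace = (Xᴴ * T Z).trace)
    {Z : Mat N} (hZ : Z.PosSemidef) : (Yᴴ * Z * Y).trace.re ≤ (Xᴴ * T Z * X).trace.re := by
  obtain ⟨S, rfl⟩ := exists_conjTranspose_mul_self_eq hZ
  have h := hT 2 ![S, S * Y] ![X, -1]
  have h1 := (Complex.nonneg_iff.1 h.trace_nonneg).1
  simp only [Fin.sum_univ_two, Matrix.cons_val_zero, Matrix.cons_val_one,
    Matrix.star_eq_conjTranspose, Matrix.conjTranspose_neg, Matrix.conjTranspose_one,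
    Matrix.conjTranspose_mul, mul_neg, neg_mul, mul_one, one_mul, neg_neg,
    Matrix.trace_add, Matrix.trace_neg, hTtr, Complex.add_re, Complex.neg_re] at h1
  have e1 : (Xᴴ * T (Sᴴ * (S * Y))).trace = (Yᴴ * (Sᴴ * S) * Y).trace := by
    rw [← hY']
    simp only [mul_assoc]
  have e2 : (T (Yᴴ * Sᴴ * S) * X).trace = (Yᴴ * (Sᴴ * S) * Y).trace := by
    rw [Matrix.trace_mul_comm, ← hY, Matrix.trace_mul_comm]
    simp only [mul_assoc]
  have e3 : (Yᴴ * Sᴴ * (S * Y)).trace = (Yᴴ * (Sᴴ * S) * Y).trace := by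
    simp only [mul_assoc]
  rw [e1, e2, e3] at h1
  linarith

/-- Monotonicity of the resolvent quasi-entropies under quantum channels. -/
theorem exists_resolventForm_ge (hT : IsCP T) (hTtr : ∀ x, (T x).trace = x.trace) {ρ σ : Mat N}
    (hρ : ρ.PosSemidef) (hσ : σ.PosSemidef) {t : ℝ} (ht : 0 < t) (X : Mat N) :
    ∃ Y, resolventForm (T ρ) (T σ) t X ≤ resolventForm ρ σ t Y := by
  obtain ⟨Y, hY⟩ := exists_trace_dual T X
  have hY' (Z : Mat N) : (Yᴴ * Z).trace = (Xᴴ * T Z).trace := by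
    have h1 := congrArg star (hY Zᴴ)
    rw [← Matrix.trace_conjTranspose, ← Matrix.trace_conjTranspose, Matrix.conjTranspose_mul,
      Matrix.conjTranspose_mul, hT.map_conjTranspose, Matrix.conjTranspose_conjTranspose,
      Matrix.conjTranspose_conjTranspose, Matrix.trace_mul_comm, Matrix.trace_mul_comm (T Z)] at h1
    exact h1
  refine ⟨Y, ?_⟩
  have h1 := hT.trace_schwarz hTtr hY hY' hσ
  have h2 := hT.trace_schwarz hTtr (X := Xᴴ) (Y := Yᴴ) hY' (by simpa using hY) hρ
  rw [Matrix.conjTranspose_conjTranspose, Matrix.conjTranspose_conjTranspose] at h2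
  rw [resolventForm, resolventForm, hY']
  nlinarith [mul_le_mul_of_nonneg_left h2 ht.le]

end Channel

section Sufficiency

open scoped Matrix

theorem cfc_congr_of_posDef {A : Mat N} (hA : A.PosDef) {f g : ℝ → ℝ}
    (h : ∀ t, 0 < t → f t = g t) : cfc f A = cfc g A := by
  obtain ⟨P, -, -, -, -, hc⟩ := exists_spectral_decomposition hA.1
  rw [hc, hc]
  exact Finset.sum_congr rfl fun i _ => by rw [h _ (hA.eigenvalues_pos i)]

theorem cfc_id_of_isHermitian {A : Mat N} (hA : A.IsHermitian) : cfc (fun t : ℝ => t) A = A :=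
  cfc_id' ℝ A hA

theorem msqrt_mul_msqrt {A : Mat N} (hA : A.PosDef) : msqrt A * msqrt A = A := by
  rw [msqrt, cfc_mul_cfc]
  conv_rhs => rw [← cfc_id_of_isHermitian hA.1]
  exact cfc_congr_of_posDef hA fun t ht => Real.mul_self_sqrt ht.le

theorem msqrt_mul_misqrt {A : Mat N} (hA : A.PosDef) : msqrt A * misqrt A = 1 := by
  rw [msqrt, misqrt, cfc_mul_cfc, ← cfc_const_one ℝ A hA.1]
  exact cfc_congr_of_posDef hA fun t ht => mul_inv_cancel₀ (Real.sqrt_pos.2 ht).ne'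

theorem misqrt_mul_msqrt {A : Mat N} (hA : A.PosDef) : misqrt A * msqrt A = 1 := by
  rw [msqrt, misqrt, cfc_mul_cfc, ← cfc_const_one ℝ A hA.1]
  exact cfc_congr_of_posDef hA fun t ht => inv_mul_cancel₀ (Real.sqrt_pos.2 ht).ne'

theorem misqrt_mul_self_mul_misqrt {A : Mat N} (hA : A.PosDef) : misqrt A * A * misqrt A = 1 := by
  have h : misqrt A * (msqrt A * msqrt A) * misqrt A = 1 := by
    rw [← mul_assoc, misqrt_mul_msqrt hA, one_mul, msqrt_mul_misqrt hA]
  rwa [msqrt_mul_msqrt hA] at h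

theorem conjTranspose_msqrt (A : Mat N) : (msqrt A)ᴴ = msqrt A :=
  (cfc_predicate Real.sqrt A : IsSelfAdjoint _).star_eq

theorem conjTranspose_misqrt (A : Mat N) : (misqrt A)ᴴ = misqrt A :=
  (cfc_predicate (fun t : ℝ => (Real.sqrt t)⁻¹) A : IsSelfAdjoint _).star_eq

theorem conjTranspose_mlog (A : Mat N) : (mlog A)ᴴ = mlog A :=
  (cfc_predicate Real.log A : IsSelfAdjoint _).star_eq

theorem re_trace_conjTranspose_sum_smul_mul {ι : Type*} [Fintype ι] (c : ι → ℝ) (R : ι → Mat N)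
    (ρ : Mat N) : ((∑ k, c k • R k)ᴴ * ρ).trace.re = ∑ k, c k * ((R k)ᴴ * ρ).trace.re := by
  simp [Matrix.conjTranspose_sum, Finset.sum_mul, Matrix.trace_sum, Matrix.trace_smul]

variable {B : StarSubalgebra ℂ (Mat N)} {E : Mat N →ₗ[ℂ] Mat N} {ρ σ : Mat N}

/-- The Petz recovery map `X ↦ σ^{1/2} (E σ)^{-1/2} E(X) (E σ)^{-1/2} σ^{1/2}` witnesses
sufficiency as soon as it recovers `ρ`. -/
theorem IsCondExp.isSufficient_of_petz (hE : IsCondExp B E) (hσ : σ.PosDef)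
    (h : msqrt σ * misqrt (E σ) * E ρ * misqrt (E σ) * msqrt σ = ρ) : IsSufficient E ρ σ := by
  have hσ' := hE.posDef_map hσ
  refine ⟨LinearMap.mulLeftRight ℂ (msqrt σ * misqrt (E σ), misqrt (E σ) * msqrt σ) ∘ₗ E,
    fun k x a => ?_, fun x => ?_, ?_, ?_⟩
  · have h1 := hE.isCP k x (fun i => misqrt (E σ) * msqrt σ * a i)
    simpa only [LinearMap.comp_apply, LinearMap.mulLeftRight_apply, Matrix.star_eq_conjTranspose,
      Matrix.conjTranspose_mul, conjTranspose_msqrt, conjTranspose_misqrt, mul_assoc] using h1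
  · have hi : misqrt (E σ) ∈ B := cfc_mem_starSubalgebra B (hE.1 σ) _
    calc _ = (misqrt (E σ) * E x * misqrt (E σ) * (msqrt σ * msqrt σ)).trace := by
          simp only [LinearMap.comp_apply, LinearMap.mulLeftRight_apply, mul_assoc]
          rw [Matrix.trace_mul_comm]
          simp only [mul_assoc]
      _ = (misqrt (E σ) * E x * misqrt (E σ) * E σ).trace := by
          rw [msqrt_mul_msqrt hσ, hE.2.2 σ _ (mul_mem (mul_mem hi (hE.1 x)) hi)]
      _ = (E x * (misqrt (E σ) * E σ * misqrt (E σ))).trace := by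
          rw [mul_assoc, mul_assoc, Matrix.trace_mul_comm]
          simp only [mul_assoc]
      _ = x.trace := by rw [misqrt_mul_self_mul_misqrt hσ', mul_one, hE.trace_map]
  · rw [LinearMap.comp_apply, hE.2.1 _ (hE.1 ρ), LinearMap.mulLeftRight_apply, ← mul_assoc]
    exact h
  · rw [LinearMap.comp_apply, hE.2.1 _ (hE.1 σ), LinearMap.mulLeftRight_apply]
    calc _ = msqrt σ * (misqrt (E σ) * E σ * misqrt (E σ)) * msqrt σ := by simp only [mul_assoc]
      _ = σ := by rw [misqrt_mul_self_mul_misqrt hσ', mul_one, msqrt_mul_msqrt hσ]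

/-- Petz's theorem for conditional expectations: equality in the monotonicity of relative entropy,
sufficiency, and recovery by the Petz map are equivalent. -/
theorem IsCondExp.petz_tfae (hE : IsCondExp B E) (hρ : ρ.PosDef) (hσ : σ.PosDef) :
    [(ρ * (mlog ρ - mlog σ)).trace.re = (E ρ * (mlog (E ρ) - mlog (E σ))).trace.re,
      IsSufficient E ρ σ,
      msqrt σ * misqrt (E σ) * E ρ * misqrt (E σ) * msqrt σ = ρ].TFAE := by
  have hρ' := hE.posDef_map hρ
  have hσ' := hE.posDef_map hσ
  obtain ⟨lam, R, hlam, hX, hsqrt, hlog, hone⟩ := exists_relative_modular_decomposition hρ hσ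
  obtain ⟨lam', R', hlam', hY, hsqrt', hlog', hone'⟩ :=
    exists_relative_modular_decomposition hρ' hσ'
  have hle (t : ℝ) (ht : 0 < t) :
      resolventForm (E ρ) (E σ) t (∑ k, (lam' k + t)⁻¹ • R' k) ≤
        resolventForm ρ σ t (∑ k, (lam k + t)⁻¹ • R k) := by
    rw [resolventForm_condExp hE ρ σ t (mem_of_resolvent_equation hE hρ hσ ht (hY t ht))]
    exact resolventForm_le hρ hσ ht (hX t ht) _
  have hfun (h : ∀ t : ℝ, 0 < t → resolventForm ρ σ t (∑ k, (lam k + t)⁻¹ • R k) ≤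
      resolventForm (E ρ) (E σ) t (∑ k, (lam' k + t)⁻¹ • R' k)) (f : ℝ → ℝ) :
      ∑ k, f (lam k) • R k = ∑ k, f (lam' k) • R' k := by
    refine sum_smul_eq_of_sum_resolvent_eq hlam hlam' (fun t ht => ?_) f
    have h1 := h t ht
    rw [resolventForm_condExp hE ρ σ t (mem_of_resolvent_equation hE hρ hσ ht (hY t ht))] at h1
    exact (eq_of_resolventForm_ge hρ hσ ht (hX t ht) h1).symm
  have hent (α β : Mat N) : (α * (mlog α - mlog β)).trace.re =
      -((mlog β - mlog α)ᴴ * α).trace.re := by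
    rw [Matrix.conjTranspose_sub, conjTranspose_mlog, conjTranspose_mlog, Matrix.trace_mul_comm,
      ← Complex.neg_re, ← Matrix.trace_neg, ← neg_mul, neg_sub]
  have hmlog (h : ∀ f : ℝ → ℝ, ∑ k, f (lam k) • R k = ∑ k, f (lam' k) • R' k) :
      (ρ * (mlog ρ - mlog σ)).trace.re = (E ρ * (mlog (E ρ) - mlog (E σ))).trace.re := by
    have hmem : (mlog (E σ) - mlog (E ρ))ᴴ ∈ B :=
      star_mem (sub_mem (cfc_mem_starSubalgebra B (hE.1 σ) _)
        (cfc_mem_starSubalgebra B (hE.1 ρ) _))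
    rw [hent, hent, ← hE.2.2 _ _ hmem, ← hlog, ← hlog', h]
  tfae_have 3 → 2 := hE.isSufficient_of_petz hσ
  have hsuff (h : IsSufficient E ρ σ) (f : ℝ → ℝ) :
      ∑ k, f (lam k) • R k = ∑ k, f (lam' k) • R' k := by
    obtain ⟨T, hT, hTtr, hTρ, hTσ⟩ := h
    refine hfun (fun t ht => ?_) f
    obtain ⟨Z, hZ⟩ := exists_resolventForm_ge hT hTtr hρ'.posSemidef hσ'.posSemidef ht
      (∑ k, (lam k + t)⁻¹ • R k)
    rw [hTρ, hTσ] at hZ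
    exact hZ.trans (resolventForm_le hρ' hσ' ht (hY t ht) Z)
  tfae_have 2 → 1 := fun h => hmlog (hsuff h)
  tfae_have 1 → 3 := by
    intro h
    have hres : ∀ f : ℝ → ℝ, ∑ k, f (lam k) • R k = ∑ k, f (lam' k) • R' k := by
      refine hfun fun t ht => le_of_sub_nonpos (le_of_eq ?_)
      have hform (s : ℝ) (hs : 0 < s) :
          ∑ i, (Sum.elim lam lam' i + s)⁻¹ * Sum.elim (fun k => ((R k)ᴴ * ρ).trace.re)
            (fun k => -((R' k)ᴴ * E ρ).trace.re) i =
          resolventForm ρ σ s (∑ k, (lam k + s)⁻¹ • R k) -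
            resolventForm (E ρ) (E σ) s (∑ k, (lam' k + s)⁻¹ • R' k) := by
        rw [resolventForm_eq_trace (hX s hs), resolventForm_eq_trace (hY s hs),
          re_trace_conjTranspose_sum_smul_mul, re_trace_conjTranspose_sum_smul_mul]
        simp only [Fintype.sum_sum_type, Sum.elim_inl, Sum.elim_inr, mul_neg,
          Finset.sum_neg_distrib, ← sub_eq_add_neg]
      rw [← hform t ht]
      refine sum_resolvent_eq_zero_of_sum_log_eq_zero ?_ ?_ ?_ ?_ ht
      · simp [hlam, hlam']
      · have h1 := re_trace_conjTranspose_sum_smul_mul (fun _ => 1) R ρ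
        have h2 := re_trace_conjTranspose_sum_smul_mul (fun _ => 1) R' (E ρ)
        simp only [one_smul, one_mul, hone, hone', Matrix.conjTranspose_one, hE.trace_map] at h1 h2
        simp only [Fintype.sum_sum_type, Sum.elim_inl, Sum.elim_inr, Finset.sum_neg_distrib,
          ← h1, ← h2, add_neg_cancel]
      · rw [hent, hent, ← hlog, ← hlog', re_trace_conjTranspose_sum_smul_mul,
          re_trace_conjTranspose_sum_smul_mul, neg_inj] at h
        simp only [Fintype.sum_sum_type, Sum.elim_inl, Sum.elim_inr, mul_neg,
          Finset.sum_neg_distrib, h, add_neg_cancel]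
      · intro s hs
        rw [hform s hs]
        exact sub_nonneg.2 (hle s hs)
    have h1 : msqrt σ * misqrt ρ = msqrt (E σ) * misqrt (E ρ) := by
      rw [← hsqrt, ← hsqrt', hres]
    have h2 : misqrt (E σ) * msqrt σ = misqrt (E ρ) * msqrt ρ := by
      calc _ = misqrt (E σ) * (msqrt σ * misqrt ρ) * msqrt ρ := by
            rw [mul_assoc, mul_assoc, misqrt_mul_msqrt hρ, mul_one]
        _ = _ := by rw [h1, ← mul_assoc, misqrt_mul_msqrt hσ', one_mul]
    have h3 : msqrt σ * misqrt (E σ) = msqrt ρ * misqrt (E ρ) := by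
      have := congrArg Matrix.conjTranspose h2
      simpa only [Matrix.conjTranspose_mul, conjTranspose_msqrt, conjTranspose_misqrt] using this
    calc _ = msqrt ρ * (misqrt (E ρ) * E ρ * misqrt (E ρ)) * msqrt ρ := by
          rw [mul_assoc (_ * E ρ), h2, h3]
          simp only [mul_assoc]
      _ = ρ := by rw [misqrt_mul_self_mul_misqrt hρ', mul_one, msqrt_mul_msqrt hρ]
  tfae_finish

end Sufficiency

/-- for a faithful state `ψ` (τ-density `ρ`, positive definite) on a commuting
square of finite-dimensional factors with the product matrix-trace assumption, strong
additivity of von Neumann entropy holds iff `E_AB` is sufficient for `(ψ, ψ ∘ E_BC)`,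
iff the canonical map `T^♯(X) = ρ_{ψBC}^{1/2} ρ_{ψB}^{-1/2} X ρ_{ψB}^{-1/2} ρ_{ψBC}^{1/2}`
recovers `ρ_ψ` from `ρ_{ψAB}`. -/
theorem stmt8 {N kAB kBC kB : ℕ} (hkAB : 0 < kAB) (hkBC : 0 < kBC) (hkB : 0 < kB)
    (hN : 0 < N) (hprod : kAB * kBC = kB * N)
    (AB BC B : StarSubalgebra ℂ (Mat N))
    (hABf : IsFactorSub AB) (hBCf : IsFactorSub BC) (hBf : IsFactorSub B)
    (EAB EBC EB : Mat N →ₗ[ℂ] Mat N)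
    (hsq : CommSquare AB BC B EAB EBC EB)
    (hszAB : HasMatSize AB kAB) (hszBC : HasMatSize BC kBC) (hszB : HasMatSize B kB)
    (ρ : Mat N) (hρpd : ρ.PosDef) (hρ1 : tau ρ = 1) :
    (Sres ρ N - Sres (EAB ρ) kAB - Sres (EBC ρ) kBC + Sres (EB ρ) kB = 0 ↔
        IsSufficient EAB ρ (EBC ρ)) ∧
      (IsSufficient EAB ρ (EBC ρ) ↔
        msqrt (EBC ρ) * misqrt (EB ρ) * EAB ρ * misqrt (EB ρ) * msqrt (EBC ρ) = ρ) := by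
  obtain ⟨hAB, hBC, hB, rfl, hcomm, -⟩ := hsq
  have htfae := hAB.petz_tfae hρpd (hBC.posDef_map hρpd)
  rw [hcomm] at htfae
  refine ⟨Iff.trans ?_ (htfae.out 0 1), htfae.out 1 2⟩
  have hBC_log : (ρ * mlog (EBC ρ)).trace = (EBC ρ * mlog (EBC ρ)).trace := by
    rw [Matrix.trace_mul_comm, Matrix.trace_mul_comm (EBC ρ)]
    exact hBC.2.2 _ _ (cfc_mem_starSubalgebra BC (hBC.1 ρ) _)
  have hB_log : (EAB ρ * mlog (EB ρ)).trace = (EB ρ * mlog (EB ρ)).trace := by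
    have hmem : mlog (EB ρ) ∈ AB ⊓ BC := cfc_mem_starSubalgebra _ (hB.1 ρ) _
    rw [Matrix.trace_mul_comm, Matrix.trace_mul_comm (EB ρ), ← hB.2.2 _ _ hmem,
      ← hAB.2.2 _ _ (StarSubalgebra.mem_inf.1 hmem).1]
  have hlog : Real.log kAB + Real.log kBC = Real.log kB + Real.log N := by
    rw [← Real.log_mul (by positivity) (by positivity), ← Real.log_mul (by positivity)
      (by positivity)]
    exact_mod_cast congrArg (fun m : ℕ => Real.log m) hprod
  have hNr : (N : ℝ) ≠ 0 := by positivity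
  simp only [Sres, Shat, tau, Complex.div_natCast_re, mul_sub, Matrix.trace_sub, Complex.sub_re,
    hBC_log, hB_log]
  have hsum : ∀ a b c d : ℝ, -(a / N) + Real.log N - (-(b / N) + Real.log kAB) -
      (-(c / N) + Real.log kBC) + (-(d / N) + Real.log kB) = -(a - c - (b - d)) / N := by
    intro a b c d
    have h1 : -(a - c - (b - d)) / N = -(a / N) + c / N + b / N - d / N := by ring
    rw [h1]
    linear_combination -hlog
  rw [hsum, div_eq_zero_iff, or_iff_left hNr, neg_eq_zero, sub_eq_zero]
end

section
/- Let A and C be disjoint regions of a graded quantum system with A_A, A_C finite-dimensional factors, and let ψ_AC be a state on A_AC with faithful marginal densities ρ_A ∈ A_A and ρ_C ∈ A_C such that ρ_{ψ_AC} = ρ_C^{1/2} ρ_A ρ_C^{1/2} and ρ_{ψ_AC} = ρ_A^{1/2} ρ_C ρ_A^{1/2}. Then at least one of ρ_A, ρ_C is even (Θ-invariant). Consequently, a state ψ_AC on the two-composed graded system A_AC satisfies the additivity of entropy S(ψ_AC) − S(ψ_A) − S(ψ_C) = 0 if and only if it is a product state for the pair (A_A, A_C); and in that case at least one of ψ_A,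 ψ_C is even. -/
open scoped ComplexOrder

variable {N : ℕ}

open Filter Topology in
/-- The function `t ↦ ∑ w r log (a + t r) - ∑ c log (1 + t c)` interpolates between
`∑ w r log a` at `t = 0` and `∑ w r log r - ∑ c log c` at `t = ∞`. If its derivative is
nonnegative, then the two values agree iff the derivative vanishes. -/
theorem sum_log_sub_eq_iff_forall_gap_eq_zero {ι κ μ : Type*} [Fintype ι] [Fintype κ] [Fintype μ]
    (w : ι → κ → ℝ) (a : ι → ℝ) (r : κ → ℝ) (c : μ → ℝ)
    (ha : ∀ i, 0 ≤ a i) (hr : ∀ k, 0 ≤ r k) (hc : ∀ j, 0 ≤ c j)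
    (hsupp : ∀ i k, a i = 0 → w i k * r k = 0)
    (hsum : ∑ i, ∑ k, w i k * r k = ∑ j, c j)
    (hgap : ∀ t : ℝ, 0 < t →
      0 ≤ ∑ i, ∑ k, w i k * r k ^ 2 / (a i + t * r k) - ∑ j, c j ^ 2 / (1 + t * c j)) :
    (∑ i, ∑ k, w i k * r k * Real.log (r k) - ∑ j, c j * Real.log (c j) =
        ∑ i, ∑ k, w i k * r k * Real.log (a i)) ↔
      ∀ t : ℝ, 0 < t →
        ∑ i, ∑ k, w i k * r k ^ 2 / (a i + t * r k) - ∑ j, c j ^ 2 / (1 + t * c j) = 0 := by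
  set gap : ℝ → ℝ := fun t =>
    ∑ i, ∑ k, w i k * r k ^ 2 / (a i + t * r k) - ∑ j, c j ^ 2 / (1 + t * c j) with hgapdef
  set phi : ℝ → ℝ := fun t =>
    ∑ i, ∑ k, w i k * r k * Real.log (a i + t * r k) - ∑ j, c j * Real.log (1 + t * c j)
    with hphi
  have hpos : ∀ t : ℝ, 0 ≤ t → ∀ j, 1 + t * c j ≠ 0 := fun t ht j =>
    (by have := mul_nonneg ht (hc j); positivity)
  have hderiv : ∀ t : ℝ, 0 < t → HasDerivAt phi (gap t) t := by
    intro t ht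
    refine HasDerivAt.sub (HasDerivAt.fun_sum fun i _ => HasDerivAt.fun_sum fun k _ => ?_)
      (HasDerivAt.fun_sum fun j _ => ?_)
    · rcases (hr k).eq_or_lt with h0 | h0
      · simpa [← h0] using hasDerivAt_const t (0 : ℝ)
      · have hne : a i + t * r k ≠ 0 := by have := ha i; positivity
        have h1 : HasDerivAt (fun t => a i + t * r k) (r k) t := by
          simpa using ((hasDerivAt_id t).mul_const (r k)).const_add (a i)
        exact ((h1.log hne).const_mul (w i k * r k)).congr_deriv (by ring)
    · have h1 : HasDerivAt (fun t => 1 + t * c j) (c j) t := by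
        simpa using ((hasDerivAt_id t).mul_const (c j)).const_add 1
      exact ((h1.log (hpos t ht.le j)).const_mul (c j)).congr_deriv (by ring)
  have hcont : ContinuousOn phi (Set.Ici 0) := by
    refine ContinuousOn.sub (continuousOn_finsetSum _ fun i _ => continuousOn_finsetSum _
      fun k _ => ?_) (continuousOn_finsetSum _ fun j _ => ?_)
    · rcases (ha i).eq_or_lt with h0 | h0
      · simpa [hsupp i k h0.symm] using continuousOn_const
      · refine continuousOn_const.mul (ContinuousOn.log (by fun_prop) fun t ht => ?_)
        have := mul_nonneg (Set.mem_Ici.1 ht) (hr k)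
        positivity
    · exact continuousOn_const.mul (ContinuousOn.log (by fun_prop) fun t ht => hpos t ht j)
  have hmono : MonotoneOn phi (Set.Ici 0) := by
    refine monotoneOn_of_deriv_nonneg (convex_Ici 0) hcont ?_ ?_
    · rw [interior_Ici]
      exact fun t ht => (hderiv t ht).differentiableAt.differentiableWithinAt
    · rw [interior_Ici]
      exact fun t ht => (hderiv t ht).deriv ▸ hgap t ht
  have hzero : phi 0 = ∑ i, ∑ k, w i k * r k * Real.log (a i) := by simp [hphi]
  have hlim : Tendsto phi atTop
      (𝓝 (∑ i, ∑ k, w i k * r k * Real.log (r k) - ∑ j, c j * Real.log (c j))) := by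
    have hshift : ∀ x b : ℝ, 0 ≤ x → 0 ≤ b →
        Tendsto (fun t : ℝ => x * Real.log (b / t + x)) atTop (𝓝 (x * Real.log x)) := by
      intro x b hx hb
      rcases hx.eq_or_lt with h0 | h0
      · simp [← h0]
      · have h1 : Tendsto (fun t : ℝ => b / t + x) atTop (𝓝 x) := by
          simpa using (tendsto_const_nhds.div_atTop tendsto_id).add_const x
        exact ((Real.continuousAt_log h0.ne').tendsto.comp h1).const_mul x
    have h1 : Tendsto (fun t : ℝ => ∑ i, ∑ k, w i k * (r k * Real.log (a i / t + r k)) -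
        ∑ j, c j * Real.log (1 / t + c j)) atTop
        (𝓝 (∑ i, ∑ k, w i k * (r k * Real.log (r k)) - ∑ j, c j * Real.log (c j))) :=
      (tendsto_finsetSum _ fun i _ => tendsto_finsetSum _ fun k _ =>
        (hshift _ _ (hr k) (ha i)).const_mul _).sub
        (tendsto_finsetSum _ fun j _ => hshift _ _ (hc j) zero_le_one)
    simp only [← mul_assoc] at h1
    refine h1.congr' ?_
    filter_upwards [eventually_gt_atTop 0] with t ht
    have hlog : ∀ x b : ℝ, 0 ≤ x → 0 ≤ b →
        x * Real.log (b + t * x) = x * Real.log (b / t + x) + x * Real.log t := by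
      intro x b hx hb
      rcases hx.eq_or_lt with h0 | h0
      · simp [← h0]
      · have : b + t * x = (b / t + x) * t := by field_simp
        rw [this, Real.log_mul (by positivity) ht.ne']
        ring
    simp only [hphi, mul_assoc, hlog _ _ (hr _) (ha _), hlog _ _ (hc _) zero_le_one, mul_add,
      Finset.sum_add_distrib]
    have h2 : ∑ i, ∑ k, w i k * (r k * Real.log t) = ∑ j, c j * Real.log t := by
      rw [← Finset.sum_mul, ← hsum, Finset.sum_mul]
      simp only [Finset.sum_mul, mul_assoc]
    rw [h2]
    ring
  constructor
  · intro heq t ht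
    have hconst : ∀ s : ℝ, 0 < s → phi s = phi 0 := by
      intro s hs
      refine le_antisymm ?_ (hmono Set.self_mem_Ici hs.le hs.le)
      rw [hzero, ← heq]
      refine ge_of_tendsto hlim ?_
      filter_upwards [eventually_ge_atTop s] with u hu
      exact hmono hs.le (hs.le.trans hu) hu
    have h1 : HasDerivAt phi 0 t := by
      refine (hasDerivAt_const t (phi 0)).congr_of_eventuallyEq ?_
      filter_upwards [lt_mem_nhds ht] with s hs using hconst s hs
    exact (hderiv t ht).unique h1
  · intro h
    have hanti : AntitoneOn phi (Set.Ici 0) := by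
      refine antitoneOn_of_deriv_nonpos (convex_Ici 0) hcont ?_ ?_
      · rw [interior_Ici]
        exact fun t ht => (hderiv t ht).differentiableAt.differentiableWithinAt
      · rw [interior_Ici]
        exact fun t ht => (hderiv t ht).deriv ▸ (h t ht).le
    rw [← hzero]
    refine tendsto_nhds_unique hlim (tendsto_const_nhds.congr' ?_)
    filter_upwards [eventually_ge_atTop 0] with t ht
    exact le_antisymm (hmono Set.self_mem_Ici ht ht) (hanti Set.self_mem_Ici ht ht)

namespace Matrix

variable {n : Type*} [Fintype n] [DecidableEq n]

theorem IsHermitian.cfc_eq_conj_diagonal {A : Matrix n n ℂ} (hA : A.IsHermitian) (f : ℝ → ℝ) :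
    cfc f A = (hA.eigenvectorUnitary : Matrix n n ℂ) *
      diagonal (fun i => (f (hA.eigenvalues i) : ℂ)) * (hA.eigenvectorUnitary : Matrix n n ℂ)ᴴ := by
  rw [hA.cfc_eq, IsHermitian.cfc, Unitary.conjStarAlgAut_apply]
  rfl

theorem IsHermitian.cfc_id_eq {A : Matrix n n ℂ} (hA : A.IsHermitian) : cfc (id : ℝ → ℝ) A = A :=
  cfc_id ℝ A (ha := hA.isSelfAdjoint)

theorem IsHermitian.cfc_one_eq {A : Matrix n n ℂ} (hA : A.IsHermitian) :
    cfc (fun _ : ℝ => (1 : ℝ)) A = 1 :=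
  cfc_const_one ℝ A (ha := hA.isSelfAdjoint)

theorem IsHermitian.eq_conj_diagonal {A : Matrix n n ℂ} (hA : A.IsHermitian) :
    A = (hA.eigenvectorUnitary : Matrix n n ℂ) *
      diagonal (fun i => (hA.eigenvalues i : ℂ)) * (hA.eigenvectorUnitary : Matrix n n ℂ)ᴴ := by
  conv_lhs => rw [← hA.cfc_id_eq]
  exact hA.cfc_eq_conj_diagonal id

theorem IsHermitian.cfc_mul_cfc {A : Matrix n n ℂ} (_hA : A.IsHermitian) (f g : ℝ → ℝ) :
    cfc f A * cfc g A = cfc (fun x => f x * g x) A :=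
  (cfc_mul f g A (A.finite_real_spectrum.continuousOn _)
    (A.finite_real_spectrum.continuousOn _)).symm

theorem IsHermitian.mul_cfc {A : Matrix n n ℂ} (hA : A.IsHermitian) (f : ℝ → ℝ) :
    A * cfc f A = cfc (fun x => x * f x) A := by
  conv_lhs => enter [1]; rw [← hA.cfc_id_eq]
  exact hA.cfc_mul_cfc id f

theorem eigenvectorUnitary_mul_conjTranspose {A : Matrix n n ℂ} (hA : A.IsHermitian) :
    (hA.eigenvectorUnitary : Matrix n n ℂ) * (hA.eigenvectorUnitary : Matrix n n ℂ)ᴴ = 1 :=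
  Unitary.coe_mul_star_self hA.eigenvectorUnitary

theorem eigenvectorUnitary_conjTranspose_mul {A : Matrix n n ℂ} (hA : A.IsHermitian) :
    (hA.eigenvectorUnitary : Matrix n n ℂ)ᴴ * (hA.eigenvectorUnitary : Matrix n n ℂ) = 1 :=
  Unitary.coe_star_mul_self hA.eigenvectorUnitary

theorem IsHermitian.trace_cfc {A : Matrix n n ℂ} (hA : A.IsHermitian) (f : ℝ → ℝ) :
    (cfc f A).trace = ((∑ i, f (hA.eigenvalues i) : ℝ) : ℂ) := by
  rw [hA.cfc_eq_conj_diagonal, trace_mul_comm, ← mul_assoc,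
    eigenvectorUnitary_conjTranspose_mul, one_mul, trace_diagonal]
  simp

theorem trace_diagonal_mul_mul_diagonal_mul_conjTranspose (d e : n → ℂ) (P Q : Matrix n n ℂ) :
    (diagonal d * P * diagonal e * Qᴴ).trace = ∑ i, ∑ k, d i * e k * (P i k * star (Q i k)) := by
  simp only [trace, diag_apply, mul_apply (M := _ * diagonal e), mul_diagonal, diagonal_mul,
    conjTranspose_apply]
  exact Finset.sum_congr rfl fun i _ => Finset.sum_congr rfl fun k _ => by ring

/-- The entries of `Y` between eigenvectors of `A` and eigenvectors of `B`. -/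
noncomputable def eigenEntries {A B : Matrix n n ℂ} (hA : A.IsHermitian) (hB : B.IsHermitian)
    (Y : Matrix n n ℂ) : Matrix n n ℂ :=
  (hA.eigenvectorUnitary : Matrix n n ℂ)ᴴ * Y * (hB.eigenvectorUnitary : Matrix n n ℂ)

theorem trace_cfc_mul_mul_cfc_mul_conjTranspose {A B : Matrix n n ℂ} (hA : A.IsHermitian)
    (hB : B.IsHermitian) (f g : ℝ → ℝ) (P Q : Matrix n n ℂ) :
    (cfc f A * P * cfc g B * Qᴴ).trace = ∑ i, ∑ k, (f (hA.eigenvalues i) : ℂ) *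
      (g (hB.eigenvalues k) : ℂ) * (eigenEntries hA hB P i k * star (eigenEntries hA hB Q i k)) := by
  rw [← trace_diagonal_mul_mul_diagonal_mul_conjTranspose, hA.cfc_eq_conj_diagonal,
    hB.cfc_eq_conj_diagonal, eigenEntries, eigenEntries]
  simp only [conjTranspose_mul, conjTranspose_conjTranspose, mul_assoc]
  rw [trace_mul_comm]
  simp only [mul_assoc]

/-- The squared overlaps between eigenvectors of `A` and eigenvectors of `B`. -/
noncomputable def eigenOverlap {A B : Matrix n n ℂ} (hA : A.IsHermitian) (hB : B.IsHermitian)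
    (i k : n) : ℝ :=
  Complex.normSq (eigenEntries hA hB 1 i k)

theorem trace_cfc_mul_cfc {A B : Matrix n n ℂ} (hA : A.IsHermitian) (hB : B.IsHermitian)
    (f g : ℝ → ℝ) :
    (cfc f A * cfc g B).trace = ((∑ i, ∑ k, f (hA.eigenvalues i) * g (hB.eigenvalues k) *
      eigenOverlap hA hB i k : ℝ) : ℂ) := by
  have h := trace_cfc_mul_mul_cfc_mul_conjTranspose hA hB f g 1 1
  rw [mul_one, conjTranspose_one, mul_one] at h
  rw [h]
  push_cast
  simp only [eigenOverlap, Complex.star_def, Complex.mul_conj]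

theorem mul_mul_eigenEntries {A B : Matrix n n ℂ} (hA : A.IsHermitian) (hB : B.IsHermitian)
    (X Y Z : Matrix n n ℂ) (t : ℂ) :
    A * X + t • (Y * B) = Z * B ↔ ∀ i k,
      eigenEntries hA hB X i k * hA.eigenvalues i + t * eigenEntries hA hB Y i k * hB.eigenvalues k
        = eigenEntries hA hB Z i k * hB.eigenvalues k := by
  have key : ∀ W : Matrix n n ℂ, W = 0 ↔ eigenEntries hA hB W = 0 := by
    intro W
    refine ⟨fun h => by simp [eigenEntries, h], fun h => ?_⟩
    have h1 : (hA.eigenvectorUnitary : Matrix n n ℂ) * eigenEntries hA hB W *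
        (hB.eigenvectorUnitary : Matrix n n ℂ)ᴴ = 0 := by rw [h, mul_zero, zero_mul]
    rw [eigenEntries] at h1
    rw [← h1]
    calc W = ((hA.eigenvectorUnitary : Matrix n n ℂ) * (hA.eigenvectorUnitary : Matrix n n ℂ)ᴴ) *
          W * ((hB.eigenvectorUnitary : Matrix n n ℂ) *
            (hB.eigenvectorUnitary : Matrix n n ℂ)ᴴ) := by
          rw [eigenvectorUnitary_mul_conjTranspose, eigenvectorUnitary_mul_conjTranspose, one_mul,
            mul_one]
      _ = _ := by simp only [mul_assoc]
  have hAX : eigenEntries hA hB (A * X) =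
      diagonal (fun i => (hA.eigenvalues i : ℂ)) * eigenEntries hA hB X := by
    conv_lhs => rw [eigenEntries]; enter [1, 2, 1]; rw [hA.eq_conj_diagonal]
    simp only [← mul_assoc, eigenEntries, eigenvectorUnitary_conjTranspose_mul, one_mul]
  have hYB : ∀ Y, eigenEntries hA hB (Y * B) =
      eigenEntries hA hB Y * diagonal (fun i => (hB.eigenvalues i : ℂ)) := by
    intro Y
    conv_lhs => rw [eigenEntries]; enter [1, 2, 2]; rw [hB.eq_conj_diagonal]
    simp only [mul_assoc, eigenEntries, eigenvectorUnitary_conjTranspose_mul, mul_one]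
  have hlin : eigenEntries hA hB (A * X + t • (Y * B) - Z * B) =
      eigenEntries hA hB (A * X) + t • eigenEntries hA hB (Y * B) - eigenEntries hA hB (Z * B) := by
    simp only [eigenEntries, mul_sub, mul_add, sub_mul, add_mul, mul_smul_comm, smul_mul_assoc]
  rw [← sub_eq_zero, key, hlin, hAX, hYB, hYB, sub_eq_zero, ← ext_iff]
  simp only [add_apply, smul_apply, diagonal_mul, mul_diagonal, smul_eq_mul]
  refine forall_congr' fun i => forall_congr' fun k => ?_
  rw [mul_comm (hA.eigenvalues i : ℂ), ← mul_assoc]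

theorem normSq_sub_div_eq {α r : ℝ} (m v : ℂ) (hα : α = 0 → r = 0) :
    Complex.normSq (α * m - r * v) / α =
      α * Complex.normSq m - 2 * r * (v * star m).re + Complex.normSq v * r ^ 2 / α := by
  rcases eq_or_ne α 0 with h | h
  · simp [h, hα h]
  · field_simp
    simp only [Complex.normSq_apply, Complex.star_def, Complex.mul_re, Complex.mul_im,
      Complex.sub_re, Complex.sub_im, Complex.ofReal_re, Complex.ofReal_im, Complex.conj_re,
      Complex.conj_im]
    ring

/-- The square-completion identity behind monotonicity of the relative entropy. -/
theorem sum_eigenOverlap_sub_eq_sum_normSq {ρ A C : Matrix n n ℂ} (hρ : ρ.PosSemidef)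
    (hA : A.PosSemidef) (hC : C.PosSemidef)
    (hAC : ∀ f : ℝ → ℝ, (A * cfc f C).trace = (cfc f C).trace)
    (hρC : ∀ f : ℝ → ℝ, (ρ * cfc f C).trace = (C * cfc f C).trace) {t : ℝ} (ht : 0 < t) :
    ∑ i, ∑ k, eigenOverlap hA.1 hρ.1 i k * hρ.1.eigenvalues k ^ 2 /
        (hA.1.eigenvalues i + t * hρ.1.eigenvalues k) -
      ∑ j, hC.1.eigenvalues j ^ 2 / (1 + t * hC.1.eigenvalues j) =
    ∑ i, ∑ k, Complex.normSq
        (((hA.1.eigenvalues i + t * hρ.1.eigenvalues k : ℝ) : ℂ) *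
          eigenEntries hA.1 hρ.1 (cfc (fun x => x / (1 + t * x)) C) i k -
        (hρ.1.eigenvalues k : ℂ) * eigenEntries hA.1 hρ.1 1 i k) /
      (hA.1.eigenvalues i + t * hρ.1.eigenvalues k) := by
  set g : ℝ → ℝ := fun x => x / (1 + t * x) with hg
  set Y := cfc g C with hY
  have hYs : Yᴴ = Y := IsSelfAdjoint.cfc (f := g) (a := C)
  have hYY : Y * Y = cfc (fun x => g x * g x) C := hC.1.cfc_mul_cfc g g
  have hone : cfc (fun _ : ℝ => (1 : ℝ)) A = 1 := hA.1.cfc_one_eq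
  have hone' : cfc (fun _ : ℝ => (1 : ℝ)) ρ = 1 := hρ.1.cfc_one_eq
  have e1 := trace_cfc_mul_mul_cfc_mul_conjTranspose hA.1 hρ.1 id (fun _ => 1) Y Y
  rw [hA.1.cfc_id_eq, hone', mul_one, hYs, mul_assoc, hYY, hAC, hC.1.trace_cfc] at e1
  have e2 := trace_cfc_mul_mul_cfc_mul_conjTranspose hA.1 hρ.1 (fun _ => 1) id Y Y
  rw [hρ.1.cfc_id_eq, hone, one_mul, hYs, mul_assoc, trace_mul_comm, mul_assoc, hYY, hρC,
    hC.1.mul_cfc, hC.1.trace_cfc] at e2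
  have e3 := trace_cfc_mul_mul_cfc_mul_conjTranspose hA.1 hρ.1 (fun _ => 1) id 1 Y
  rw [hρ.1.cfc_id_eq, hone, one_mul, one_mul, hYs, hρC,
    hC.1.mul_cfc, hC.1.trace_cfc] at e3
  replace e1 := congrArg Complex.re e1
  replace e2 := congrArg Complex.re e2
  replace e3 := congrArg Complex.re e3
  simp only [Complex.ofReal_re, Complex.re_sum, Complex.star_def, Complex.mul_conj, id,
    Complex.ofReal_one, one_mul, mul_one, ← Complex.ofReal_mul, Complex.re_ofReal_mul] at e1 e2 e3
  have hnn : ∀ i k, hA.1.eigenvalues i + t * hρ.1.eigenvalues k = 0 → hρ.1.eigenvalues k = 0 := by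
    intro i k h
    have h1 := hA.eigenvalues_nonneg i
    have h2 := hρ.eigenvalues_nonneg k
    nlinarith
  simp only [fun i k => normSq_sub_div_eq (eigenEntries hA.1 hρ.1 Y i k)
    (eigenEntries hA.1 hρ.1 1 i k) (hnn i k), Finset.sum_add_distrib, Finset.sum_sub_distrib,
    add_mul, mul_assoc, ← Finset.mul_sum, Complex.star_def]
  simp only [← Finset.mul_sum] at e1
  rw [← e1, ← e2, ← e3]
  have hterm : ∀ j, hC.1.eigenvalues j ^ 2 / (1 + t * hC.1.eigenvalues j) =
      2 * (hC.1.eigenvalues j * g (hC.1.eigenvalues j)) -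
        g (hC.1.eigenvalues j) * g (hC.1.eigenvalues j) -
        t * (hC.1.eigenvalues j * (g (hC.1.eigenvalues j) * g (hC.1.eigenvalues j))) := by
    intro j
    have h2 := hC.eigenvalues_nonneg j
    have : 1 + t * hC.1.eigenvalues j ≠ 0 := by positivity
    simp only [hg]
    field_simp
    ring
  simp only [hterm, Finset.sum_sub_distrib, ← Finset.mul_sum, eigenOverlap]
  ring

/-- Equality in the subadditivity of entropy, for a density `ρ` with marginals `A` and `C`. -/
theorem trace_mul_cfc_log_eq_iff {ρ A C : Matrix n n ℂ} (hρ : ρ.PosSemidef)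
    (hA : A.PosSemidef) (hC : C.PosSemidef)
    (hAC : ∀ f : ℝ → ℝ, (A * cfc f C).trace = (cfc f C).trace)
    (hρC : ∀ f : ℝ → ℝ, (ρ * cfc f C).trace = (C * cfc f C).trace)
    (hρA : ∀ f : ℝ → ℝ, (ρ * cfc f A).trace = (A * cfc f A).trace) :
    (ρ * cfc Real.log ρ).trace.re =
        (A * cfc Real.log A).trace.re + (C * cfc Real.log C).trace.re ↔
      ∀ t : ℝ, 0 < t → A * cfc (fun x => x / (1 + t * x)) C +
        (t : ℂ) • (cfc (fun x => x / (1 + t * x)) C * ρ) = ρ := by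
  have ha := hA.eigenvalues_nonneg
  have hr := hρ.eigenvalues_nonneg
  have hc := hC.eigenvalues_nonneg
  have hw : ∀ i k, 0 ≤ eigenOverlap hA.1 hρ.1 i k := fun i k => Complex.normSq_nonneg _
  have hone : cfc (fun _ : ℝ => (1 : ℝ)) A = 1 := hA.1.cfc_one_eq
  have hone' : cfc (fun _ : ℝ => (1 : ℝ)) C = 1 := hC.1.cfc_one_eq
  have hmarg : ∀ f : ℝ → ℝ, ∑ i, ∑ k, eigenOverlap hA.1 hρ.1 i k * hρ.1.eigenvalues k *
      f (hA.1.eigenvalues i) = ∑ i, hA.1.eigenvalues i * f (hA.1.eigenvalues i) := by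
    intro f
    have h := hρA f
    rw [trace_mul_comm, hA.1.mul_cfc, hA.1.trace_cfc] at h
    nth_rewrite 1 [← hρ.1.cfc_id_eq] at h
    rw [trace_cfc_mul_cfc hA.1 hρ.1, Complex.ofReal_inj] at h
    rw [← h]
    exact Finset.sum_congr rfl fun i _ => Finset.sum_congr rfl fun k _ => by simp only [id]; ring
  have hself : ∀ g : ℝ → ℝ, ∑ i, ∑ k, eigenOverlap hA.1 hρ.1 i k * g (hρ.1.eigenvalues k) =
      ∑ k, g (hρ.1.eigenvalues k) := by
    intro g
    have h := trace_cfc_mul_cfc hA.1 hρ.1 (fun _ => 1) g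
    rw [hone, one_mul, hρ.1.trace_cfc, Complex.ofReal_inj] at h
    rw [h]
    exact Finset.sum_congr rfl fun i _ => Finset.sum_congr rfl fun k _ => by ring
  have hsupp : ∀ i k, hA.1.eigenvalues i = 0 →
      eigenOverlap hA.1 hρ.1 i k * hρ.1.eigenvalues k = 0 := by
    intro i k hi
    have h := hmarg (fun x => if x = 0 then 1 else 0)
    rw [Finset.sum_eq_zero (f := fun i => hA.1.eigenvalues i * _) (by simp)] at h
    have hn : ∀ i k, 0 ≤ eigenOverlap hA.1 hρ.1 i k * hρ.1.eigenvalues k *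
        (if hA.1.eigenvalues i = 0 then 1 else 0) := fun i k =>
      mul_nonneg (mul_nonneg (hw i k) (hr k)) (by split_ifs <;> norm_num)
    rw [Finset.sum_eq_zero_iff_of_nonneg fun i _ => Finset.sum_nonneg fun k _ => hn i k] at h
    have h2 := h i (Finset.mem_univ i)
    rw [Finset.sum_eq_zero_iff_of_nonneg fun k _ => hn i k] at h2
    simpa [hi] using h2 k (Finset.mem_univ k)
  have hsum : ∑ i, ∑ k, eigenOverlap hA.1 hρ.1 i k * hρ.1.eigenvalues k =
      ∑ j, hC.1.eigenvalues j := by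
    have h := hρC (fun _ => 1)
    rw [hC.1.mul_cfc, hC.1.trace_cfc, hone', mul_one] at h
    nth_rewrite 1 [← hρ.1.cfc_id_eq] at h
    rw [hρ.1.trace_cfc, Complex.ofReal_inj] at h
    simpa only [id, mul_one] using (hself id).trans h
  have hid := fun t (ht : 0 < t) => sum_eigenOverlap_sub_eq_sum_normSq hρ hA hC hAC hρC ht
  have hterm : ∀ t : ℝ, 0 < t → ∀ z : n → n → ℂ, ∀ i k, 0 ≤ Complex.normSq (z i k) /
      (hA.1.eigenvalues i + t * hρ.1.eigenvalues k) := fun t ht z i k =>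
    div_nonneg (Complex.normSq_nonneg _) (add_nonneg (ha i) (mul_nonneg ht.le (hr k)))
  have key := sum_log_sub_eq_iff_forall_gap_eq_zero (eigenOverlap hA.1 hρ.1) hA.1.eigenvalues
    hρ.1.eigenvalues hC.1.eigenvalues ha hr hc hsupp hsum (fun t ht => by
      rw [hid t ht]
      exact Finset.sum_nonneg fun i _ => Finset.sum_nonneg fun k _ => hterm t ht
        (fun i k => _ - _) i k)
  rw [hmarg Real.log] at key
  have hself' := hself (fun x => x * Real.log x)
  simp only [← mul_assoc] at hself'
  rw [hρ.1.mul_cfc, hA.1.mul_cfc, hC.1.mul_cfc, hρ.1.trace_cfc, hA.1.trace_cfc, hC.1.trace_cfc,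
    Complex.ofReal_re, Complex.ofReal_re, Complex.ofReal_re, ← sub_eq_iff_eq_add, ← hself']
  rw [key]
  refine forall_congr' fun t => forall_congr' fun ht => ?_
  rw [hid t ht]
  have hmul := mul_mul_eigenEntries hA.1 hρ.1 (cfc (fun x => x / (1 + t * x)) C)
    (cfc (fun x => x / (1 + t * x)) C) 1 t
  rw [one_mul] at hmul
  rw [hmul, Finset.sum_eq_zero_iff_of_nonneg fun i _ => Finset.sum_nonneg fun k _ => hterm t ht
    (fun i k => _ - _) i k]
  simp only [Finset.mem_univ, true_imp_iff]
  refine forall_congr' fun i => ?_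
  rw [Finset.sum_eq_zero_iff_of_nonneg fun k _ => hterm t ht (fun i k => _ - _) i k]
  simp only [Finset.mem_univ, true_imp_iff]
  refine forall_congr' fun k => ?_
  rw [div_eq_zero_iff, Complex.normSq_eq_zero, sub_eq_zero]
  have hcomb : ∀ m v : ℂ, ((hA.1.eigenvalues i + t * hρ.1.eigenvalues k : ℝ) : ℂ) * m =
      (hρ.1.eigenvalues k : ℂ) * v ↔ m * hA.1.eigenvalues i + t * m * hρ.1.eigenvalues k =
        v * hρ.1.eigenvalues k := fun m v => by
    push_cast
    constructor <;> intro h <;> linear_combination h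
  rw [hcomb, or_iff_left_iff_imp]
  intro h0
  have h1 := mul_nonneg ht.le (hr k)
  have h2 : hA.1.eigenvalues i = 0 := by linarith [ha i]
  have h3 : hρ.1.eigenvalues k = 0 := by
    rcases mul_eq_zero.1 (show t * hρ.1.eigenvalues k = 0 by linarith [ha i]) with h | h
    · exact absurd h ht.ne'
    · exact h
  simp [h2, h3]

open Filter Topology in
theorem IsHermitian.tendsto_cfc_div_one_add_mul {C : Matrix n n ℂ} (hC : C.IsHermitian) :
    Tendsto (fun t : ℝ => cfc (fun x : ℝ => x / (1 + t * x)) C) (𝓝 0) (𝓝 C) := by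
  conv => enter [3, 1]; rw [hC.eq_conj_diagonal]
  simp only [hC.cfc_eq_conj_diagonal]
  have hdiag : Tendsto (fun t : ℝ => diagonal fun i =>
      ((hC.eigenvalues i / (1 + t * hC.eigenvalues i) : ℝ) : ℂ)) (𝓝 0)
      (𝓝 (diagonal fun i => (hC.eigenvalues i : ℂ))) := by
    refine ((continuous_id.matrix_diagonal).tendsto _).comp (tendsto_pi_nhds.2 fun i => ?_)
    refine (Complex.continuous_ofReal.tendsto _).comp ?_
    have h : ContinuousAt (fun t : ℝ => hC.eigenvalues i / (1 + t * hC.eigenvalues i)) 0 :=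
      ContinuousAt.div (by fun_prop) (by fun_prop) (by simp)
    simpa [ContinuousAt] using h
  exact (hdiag.const_mul _).mul_const _

open Filter Topology in
/-- Equality in the subadditivity of entropy forces the density to be the product of the
marginals. -/
theorem eq_mul_of_trace_mul_cfc_log_eq {ρ A C : Matrix n n ℂ} (hρ : ρ.PosSemidef)
    (hA : A.PosSemidef) (hC : C.PosSemidef)
    (hAC : ∀ f : ℝ → ℝ, (A * cfc f C).trace = (cfc f C).trace)
    (hρC : ∀ f : ℝ → ℝ, (ρ * cfc f C).trace = (C * cfc f C).trace)
    (hρA : ∀ f : ℝ → ℝ, (ρ * cfc f A).trace = (A * cfc f A).trace)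
    (h : (ρ * cfc Real.log ρ).trace.re =
        (A * cfc Real.log A).trace.re + (C * cfc Real.log C).trace.re) : ρ = A * C := by
  rw [trace_mul_cfc_log_eq_iff hρ hA hC hAC hρC hρA] at h
  have hY := hC.1.tendsto_cfc_div_one_add_mul
  have ht : Tendsto (fun t : ℝ => (t : ℂ)) (𝓝 0) (𝓝 0) := by
    simpa using Complex.continuous_ofReal.tendsto 0
  have hlim := (hY.const_mul A).add (ht.smul (hY.mul_const ρ))
  rw [zero_smul, add_zero] at hlim
  refine tendsto_nhds_unique (tendsto_const_nhds.congr' ?_)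
    (hlim.mono_left (nhdsWithin_le_nhds (s := Set.Ioi 0)))
  filter_upwards [self_mem_nhdsWithin] with t ht using (h t ht).symm

theorem trace_mul_cfc_log_eq_of_eq_mul {ρ A C : Matrix n n ℂ} (hρ : ρ.PosSemidef)
    (hA : A.PosSemidef) (hC : C.PosSemidef)
    (hAC : ∀ f : ℝ → ℝ, (A * cfc f C).trace = (cfc f C).trace)
    (hρC : ∀ f : ℝ → ℝ, (ρ * cfc f C).trace = (C * cfc f C).trace)
    (hρA : ∀ f : ℝ → ℝ, (ρ * cfc f A).trace = (A * cfc f A).trace)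
    (hcomm : A * C = C * A) (h : ρ = A * C) :
    (ρ * cfc Real.log ρ).trace.re =
      (A * cfc Real.log A).trace.re + (C * cfc Real.log C).trace.re := by
  rw [trace_mul_cfc_log_eq_iff hρ hA hC hAC hρC hρA]
  intro t ht
  set g : ℝ → ℝ := fun x => x / (1 + t * x) with hg
  have hAY : cfc g C * A = A * cfc g C := (Commute.cfc_real (show Commute C A from hcomm.symm) g)
  have hY : cfc g C + (t : ℂ) • (cfc g C * C) = C := by
    have hYC : cfc g C * C = cfc (fun x => g x * id x) C := by
      rw [← hC.1.cfc_mul_cfc, hC.1.cfc_id_eq]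
    rw [hYC]
    conv_rhs => rw [hC.1.eq_conj_diagonal]
    rw [hC.1.cfc_eq_conj_diagonal, hC.1.cfc_eq_conj_diagonal, ← smul_mul_assoc, ← mul_smul_comm,
      ← add_mul, ← mul_add, ← diagonal_smul, diagonal_add]
    congr 3
    ext j
    have h2 := hC.eigenvalues_nonneg j
    have h3 : (1 + t * hC.1.eigenvalues j : ℝ) ≠ 0 := by positivity
    have h4 : g (hC.1.eigenvalues j) + t * (g (hC.1.eigenvalues j) * hC.1.eigenvalues j) =
        hC.1.eigenvalues j := by
      simp only [hg]
      field_simp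
    simpa using congrArg Complex.ofReal h4
  calc A * cfc g C + (t : ℂ) • (cfc g C * ρ)
      = A * (cfc g C + (t : ℂ) • (cfc g C * C)) := by
        rw [h, ← mul_assoc, hAY, mul_add, mul_smul_comm, mul_assoc]
    _ = ρ := by rw [hY, h]

end Matrix

namespace IsCondExp

variable {B : StarSubalgebra ℂ (Mat N)} {E : Mat N →ₗ[ℂ] Mat N}

theorem trace_mul (hE : IsCondExp B E) (x : Mat N) {b : Mat N} (hb : b ∈ B) :
    (x * b).trace = (E x * b).trace := by
  rw [Matrix.trace_mul_comm, hE.2.2 x b hb, Matrix.trace_mul_comm]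

theorem tau_mul (hE : IsCondExp B E) (x : Mat N) {b : Mat N} (hb : b ∈ B) :
    tau (x * b) = tau (E x * b) := by
  rw [tau, tau, hE.trace_mul x hb]

theorem tau_apply (hE : IsCondExp B E) (x : Mat N) : tau (E x) = tau x := by
  simpa using (hE.tau_mul x (one_mem B)).symm

end IsCondExp

namespace StarSubalgebra

theorem eq_of_forall_trace_mul_eq {B : StarSubalgebra ℂ (Mat N)} {x y : Mat N} (hx : x ∈ B)
    (hy : y ∈ B) (h : ∀ b ∈ B, (b * x).trace = (b * y).trace) : x = y := by
  rw [← sub_eq_zero, ← Matrix.trace_conjTranspose_mul_self_eq_zero_iff, mul_sub, Matrix.trace_sub,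
    sub_eq_zero]
  exact h _ (star_mem (sub_mem hx hy))

theorem cfc_mem_of_mem {B : StarSubalgebra ℂ (Mat N)} {x : Mat N} (hx : x ∈ B) (f : ℝ → ℝ) :
    cfc f x ∈ B := by
  have : IsClosed (B : Set (Mat N)) :=
    Submodule.closed_of_finiteDimensional B.toSubalgebra.toSubmodule
  exact cfc_mem (s := B) f hx

end StarSubalgebra

theorem IsCondExp.isHermitian {B : StarSubalgebra ℂ (Mat N)} {E : Mat N →ₗ[ℂ] Mat N}
    (hE : IsCondExp B E) {ρ : Mat N} (hρ : ρ.IsHermitian) : (E ρ).IsHermitian := by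
  refine StarSubalgebra.eq_of_forall_trace_mul_eq (star_mem (hE.1 ρ)) (hE.1 ρ) fun b hb => ?_
  have h := congrArg star (hE.trace_mul ρ (star_mem hb))
  rw [← Matrix.trace_conjTranspose, ← Matrix.trace_conjTranspose, Matrix.conjTranspose_mul,
    Matrix.conjTranspose_mul, hρ, Matrix.star_eq_conjTranspose,
    Matrix.conjTranspose_conjTranspose] at h
  exact h.symm.trans (hE.2.2 ρ b hb)

theorem IsCondExp.posSemidef {B : StarSubalgebra ℂ (Mat N)} {E : Mat N →ₗ[ℂ] Mat N}
    (hE : IsCondExp B E) {ρ : Mat N} (hρ : ρ.PosSemidef) : (E ρ).PosSemidef := by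
  have hH := hE.isHermitian hρ.1
  rw [hH.posSemidef_iff_eigenvalues_nonneg]
  set f : ℝ → ℝ := fun x => if x < 0 then 1 else 0 with hf
  have hff : cfc f (E ρ) * cfc f (E ρ) = cfc f (E ρ) := by
    rw [hH.cfc_mul_cfc]
    congr 1
    ext x
    simp only [hf]
    split_ifs <;> norm_num
  have hfs : (cfc f (E ρ)).conjTranspose = cfc f (E ρ) := IsSelfAdjoint.cfc (f := f) (a := E ρ)
  have hpos : 0 ≤ (ρ * cfc f (E ρ)).trace := by
    have h := (hρ.mul_mul_conjTranspose_same (cfc f (E ρ))).trace_nonneg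
    rwa [Matrix.trace_mul_comm, hfs, ← mul_assoc, hff, Matrix.trace_mul_comm] at h
  rw [hE.trace_mul ρ (StarSubalgebra.cfc_mem_of_mem (hE.1 ρ) f), hH.mul_cfc, hH.trace_cfc,
    Complex.zero_le_real] at hpos
  have hneg : ∀ i ∈ Finset.univ, hH.eigenvalues i * f (hH.eigenvalues i) ≤ 0 := by
    intro i _
    simp only [hf]
    split_ifs with h
    · linarith
    · simp
  have h0 := (Finset.sum_eq_zero_iff_of_nonpos hneg).1 (le_antisymm (Finset.sum_nonpos hneg) hpos)
  intro i
  by_contra hi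
  have hi' : hH.eigenvalues i < 0 := not_le.1 hi
  have := h0 i (Finset.mem_univ i)
  simp only [hf, if_pos hi', mul_one] at this
  exact hi'.ne this

section Grading

variable {Θ : Mat N ≃⋆ₐ[ℂ] Mat N}

theorem trace_starAlgEquiv (Θ : Mat N ≃⋆ₐ[ℂ] Mat N) (x : Mat N) : (Θ x).trace = x.trace :=
  Matrix.trace_map' Θ x

/-- The even part of `x` for the grading `Θ`. -/
noncomputable def evenPart (Θ : Mat N ≃⋆ₐ[ℂ] Mat N) (x : Mat N) : Mat N := (2⁻¹ : ℂ) • (x + Θ x)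

/-- The odd part of `x` for the grading `Θ`. -/
noncomputable def oddPart (Θ : Mat N ≃⋆ₐ[ℂ] Mat N) (x : Mat N) : Mat N := (2⁻¹ : ℂ) • (x - Θ x)

theorem evenPart_add_oddPart (Θ : Mat N ≃⋆ₐ[ℂ] Mat N) (x : Mat N) :
    evenPart Θ x + oddPart Θ x = x := by
  simp only [evenPart, oddPart]
  module

theorem map_evenPart (hΘ : IsGrading Θ) (x : Mat N) : Θ (evenPart Θ x) = evenPart Θ x := by
  rw [evenPart, map_smul, map_add, hΘ, add_comm]

theorem map_oddPart (hΘ : IsGrading Θ) (x : Mat N) : Θ (oddPart Θ x) = -oddPart Θ x := by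
  rw [oddPart, map_smul, map_sub, hΘ, ← smul_neg, neg_sub]

theorem map_eq_self_of_oddPart_eq_zero {x : Mat N} (h : oddPart Θ x = 0) : Θ x = x := by
  rw [oddPart, smul_eq_zero, sub_eq_zero] at h
  exact (h.resolve_left (by norm_num)).symm

theorem ThetaInvariant.evenPart_mem {B : StarSubalgebra ℂ (Mat N)} (hB : ThetaInvariant Θ B)
    {x : Mat N} (hx : x ∈ B) : evenPart Θ x ∈ B :=
  B.smul_mem (add_mem hx (hB x hx)) _

theorem ThetaInvariant.oddPart_mem {B : StarSubalgebra ℂ (Mat N)} (hB : ThetaInvariant Θ B)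
    {x : Mat N} (hx : x ∈ B) : oddPart Θ x ∈ B :=
  B.smul_mem (sub_mem hx (hB x hx)) _

theorem trace_eq_zero_of_map_eq_neg {x : Mat N} (hx : Θ x = -x) : x.trace = 0 := by
  have h := trace_starAlgEquiv Θ x
  rw [hx, Matrix.trace_neg] at h
  linear_combination (-1 / 2 : ℂ) * h

theorem trace_mul_star_oddPart (hΘ : IsGrading Θ) (x : Mat N) :
    (x * star (oddPart Θ x)).trace = (oddPart Θ x * star (oddPart Θ x)).trace := by
  conv_lhs => enter [1, 1]; rw [← evenPart_add_oddPart Θ x]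
  rw [add_mul, Matrix.trace_add, add_eq_right]
  apply trace_eq_zero_of_map_eq_neg (Θ := Θ)
  rw [map_mul, map_star, map_evenPart hΘ, map_oddPart hΘ, star_neg, mul_neg]

end Grading

section GradedPair

variable {Θ : Mat N ≃⋆ₐ[ℂ] Mat N} {SA SC : StarSubalgebra ℂ (Mat N)}

theorem tau_mul_eq_mul_tau [NeZero N] (hΘ : IsGrading Θ) (hAinv : ThetaInvariant Θ SA)
    (hCinv : ThetaInvariant Θ SC) (hfA : IsFactorSub SA) (hcomm : GradedComm Θ SA SC)
    {EA : Mat N →ₗ[ℂ] Mat N} (hEA : IsCondExp SA EA) {x y : Mat N} (hx : x ∈ SA) (hy : y ∈ SC) :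
    tau (x * y) = tau x * tau y := by
  have hodd : ∀ x ∈ SA, ∀ y ∈ SC, Θ y = -y → (x * y).trace = 0 := by
    intro x hx y hy hΘy
    have h1 : (evenPart Θ x * y).trace = 0 := by
      apply trace_eq_zero_of_map_eq_neg (Θ := Θ)
      rw [map_mul, map_evenPart hΘ, hΘy, mul_neg]
    have h2 : (oddPart Θ x * y).trace = 0 := by
      have h := congrArg Matrix.trace
        ((hcomm _ (hAinv.oddPart_mem hx) y hy).2 (map_oddPart hΘ x) hΘy)
      rw [Matrix.trace_add, Matrix.trace_mul_comm y, Matrix.trace_zero] at h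
      linear_combination (1 / 2 : ℂ) * h
    rw [← evenPart_add_oddPart Θ x, add_mul, Matrix.trace_add, h1, h2, add_zero]
  have heven : ∀ y ∈ SC, Θ y = y → ∃ c : ℂ, EA y = c • 1 := by
    intro y hy hΘy
    refine hfA _ (hEA.1 y) fun x hx => ?_
    refine StarSubalgebra.eq_of_forall_trace_mul_eq (mul_mem (hEA.1 y) hx)
      (mul_mem hx (hEA.1 y)) fun b hb => ?_
    rw [← mul_assoc, ← mul_assoc, Matrix.trace_mul_comm, ← mul_assoc,
      ← hEA.2.2 y _ (mul_mem hx hb), ← hEA.2.2 y _ (mul_mem hb hx), mul_assoc,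
      Matrix.trace_mul_comm, mul_assoc, mul_assoc, ((hcomm x hx y hy).1 (Or.inr hΘy))]
  have hN : (N : ℂ) ≠ 0 := NeZero.ne _
  obtain ⟨c, hc⟩ := heven _ (hCinv.evenPart_mem hy) (map_evenPart hΘ y)
  have hty : tau y = c := by
    have h1 := trace_eq_zero_of_map_eq_neg (map_oddPart hΘ y)
    have h2 := hEA.2.2 (evenPart Θ y) 1 (one_mem _)
    rw [one_mul, one_mul, hc, Matrix.trace_smul, Matrix.trace_one] at h2
    rw [tau, ← evenPart_add_oddPart Θ y, Matrix.trace_add, h1, h2, add_zero, Fintype.card_fin,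
      smul_eq_mul, mul_div_cancel_right₀ _ hN]
  rw [hty, tau, tau, ← evenPart_add_oddPart Θ y, mul_add, Matrix.trace_add,
    hodd x hx _ (hCinv.oddPart_mem hy) (map_oddPart hΘ y), add_zero, hEA.2.2 _ x hx, hc,
    mul_smul_comm, mul_one, Matrix.trace_smul, smul_eq_mul]
  ring

/-- The products of elements of the two regions span the generated algebra. -/
theorem mem_span_mul (hΘ : IsGrading Θ) (hAinv : ThetaInvariant Θ SA)
    (hCinv : ThetaInvariant Θ SC) (hcomm : GradedComm Θ SA SC) (hgen : SA ⊔ SC = ⊤) (z : Mat N) :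
    z ∈ Submodule.span ℂ {w : Mat N | ∃ x ∈ SA, ∃ y ∈ SC, w = x * y} := by
  set W := Submodule.span ℂ {w : Mat N | ∃ x ∈ SA, ∃ y ∈ SC, w = x * y} with hW
  have hmul : ∀ x ∈ SA, ∀ y ∈ SC, x * y ∈ W := fun x hx y hy =>
    Submodule.subset_span ⟨x, hx, y, hy, rfl⟩
  have hind : ∀ z : Mat N, (∀ x ∈ SA, ∀ y ∈ SC, z * (x * y) ∈ W) → ∀ w ∈ W, z * w ∈ W := by
    intro z hz w hw
    induction hw using Submodule.span_induction with
    | mem w h => obtain ⟨x, hx, y, hy, rfl⟩ := h; exact hz x hx y hy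
    | zero => rw [mul_zero]; exact zero_mem W
    | add u v _ _ hu hv => rw [mul_add]; exact add_mem hu hv
    | smul c u _ hu => rw [mul_smul_comm]; exact W.smul_mem c hu
  have hA : ∀ x ∈ SA, ∀ w ∈ W, x * w ∈ W := fun x hx => hind x fun x' hx' y' hy' => by
    rw [← mul_assoc]
    exact hmul _ (mul_mem hx hx') _ hy'
  have hC : ∀ y ∈ SC, ∀ w ∈ W, y * w ∈ W := fun y hy => hind y fun x hx y' hy' => by
    have h1 := (hcomm _ (hAinv.evenPart_mem hx) y hy).1 (Or.inl (map_evenPart hΘ x))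
    have h2 := (hcomm _ (hAinv.oddPart_mem hx) _ (hCinv.evenPart_mem hy)).1
      (Or.inr (map_evenPart hΘ y))
    have h3 := (hcomm _ (hAinv.oddPart_mem hx) _ (hCinv.oddPart_mem hy)).2
      (map_oddPart hΘ x) (map_oddPart hΘ y)
    have h4 : y * (x * y') = evenPart Θ x * (y * y') + oddPart Θ x * (evenPart Θ y * y') -
        oddPart Θ x * (oddPart Θ y * y') := by
      calc y * (x * y') = y * evenPart Θ x * y' + y * oddPart Θ x * y' := by
            conv_lhs => rw [← evenPart_add_oddPart Θ x]
            noncomm_ring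
        _ = y * evenPart Θ x * y' + evenPart Θ y * oddPart Θ x * y' +
            oddPart Θ y * oddPart Θ x * y' := by
            conv_lhs => enter [2, 1, 1]; rw [← evenPart_add_oddPart Θ y]
            noncomm_ring
        _ = _ := by
            rw [← h1, ← h2, eq_neg_of_add_eq_zero_right h3]
            noncomm_ring
    rw [h4]
    exact sub_mem (add_mem (hmul _ (hAinv.evenPart_mem hx) _ (mul_mem hy hy'))
      (hmul _ (hAinv.oddPart_mem hx) _ (mul_mem (hCinv.evenPart_mem hy) hy')))
      (hmul _ (hAinv.oddPart_mem hx) _ (mul_mem (hCinv.oddPart_mem hy) hy'))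
  let T : StarSubalgebra ℂ (Mat N) :=
    { carrier := {z | ∀ w ∈ W, z * w ∈ W ∧ star z * w ∈ W}
      mul_mem' := fun {a b} ha hb w hw => by
        rw [star_mul, mul_assoc, mul_assoc]
        exact ⟨(ha _ (hb w hw).1).1, (hb _ (ha w hw).2).2⟩
      add_mem' := fun {a b} ha hb w hw => by
        rw [star_add, add_mul, add_mul]
        exact ⟨add_mem (ha w hw).1 (hb w hw).1, add_mem (ha w hw).2 (hb w hw).2⟩
      algebraMap_mem' := fun c w hw => by
        rw [Algebra.algebraMap_eq_smul_one, star_smul, star_one, smul_mul_assoc, smul_mul_assoc,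
          one_mul]
        exact ⟨W.smul_mem _ hw, W.smul_mem _ hw⟩
      star_mem' := fun {a} ha w hw => by
        rw [star_star]
        exact (ha w hw).symm }
  have hT : SA ⊔ SC ≤ T := sup_le
    (fun x hx w hw => ⟨hA x hx w hw, hA _ (star_mem hx) w hw⟩)
    (fun y hy w hw => ⟨hC y hy w hw, hC _ (star_mem hy) w hw⟩)
  have hz : z ∈ T := hT (hgen ▸ StarSubalgebra.mem_top)
  have h1 : (1 : Mat N) ∈ W := by simpa using hmul 1 (one_mem _) 1 (one_mem _)
  simpa using (hz 1 h1).1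

theorem eq_of_forall_trace_mul_mul_eq (hΘ : IsGrading Θ) (hAinv : ThetaInvariant Θ SA)
    (hCinv : ThetaInvariant Θ SC) (hcomm : GradedComm Θ SA SC) (hgen : SA ⊔ SC = ⊤) {ρ σ : Mat N}
    (h : ∀ x ∈ SA, ∀ y ∈ SC, (ρ * (x * y)).trace = (σ * (x * y)).trace) : ρ = σ := by
  refine Matrix.ext_iff_trace_mul_right.2 fun z => ?_
  induction mem_span_mul hΘ hAinv hCinv hcomm hgen z using Submodule.span_induction with
  | mem w hw => obtain ⟨x, hx, y, hy, rfl⟩ := hw; exact h x hx y hy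
  | zero => simp
  | add u v _ _ hu hv => simp only [mul_add, Matrix.trace_add, hu, hv]
  | smul c u _ hu => simp only [mul_smul_comm, Matrix.trace_smul, hu]

/-- Commuting elements of the two regions cannot both have a nonzero odd part. -/
theorem map_eq_self_or_of_commute [NeZero N] (hΘ : IsGrading Θ) (hAinv : ThetaInvariant Θ SA)
    (hCinv : ThetaInvariant Θ SC) (hfA : IsFactorSub SA) (hcomm : GradedComm Θ SA SC)
    {EA : Mat N →ₗ[ℂ] Mat N} (hEA : IsCondExp SA EA) {x y : Mat N} (hx : x ∈ SA) (hy : y ∈ SC)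
    (hxy : x * y = y * x) : Θ x = x ∨ Θ y = y := by
  have hN : (N : ℂ) ≠ 0 := NeZero.ne _
  set x' := oddPart Θ x with hx'
  set y' := oddPart Θ y with hy'
  have hxm : x' ∈ SA := hAinv.oddPart_mem hx
  have hym : y' ∈ SC := hCinv.oddPart_mem hy
  have h1 := (hcomm _ (hAinv.evenPart_mem hx) y hy).1 (Or.inl (map_evenPart hΘ x))
  have h2 := (hcomm _ hxm _ (hCinv.evenPart_mem hy)).1 (Or.inr (map_evenPart hΘ y))
  have h3 := (hcomm _ hxm _ hym).2 (map_oddPart hΘ x) (map_oddPart hΘ y)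
  have h0 : x' * y' = 0 := by
    have e : x * y - y * x = (evenPart Θ x * y - y * evenPart Θ x) +
        (x' * evenPart Θ y - evenPart Θ y * x') + (x' * y' - y' * x') := by
      have e1 : evenPart Θ x = x - x' := eq_sub_of_add_eq (evenPart_add_oddPart Θ x)
      have e2 : evenPart Θ y = y - y' := eq_sub_of_add_eq (evenPart_add_oddPart Θ y)
      rw [e1, e2]
      noncomm_ring
    rw [hxy, h1, h2, eq_neg_of_add_eq_zero_right h3, sub_self, sub_self, sub_self, zero_add,
      zero_add, sub_neg_eq_add, ← two_smul ℂ] at e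
    exact (smul_eq_zero.1 e.symm).resolve_left two_ne_zero
  have h4 : tau (star x' * x') * tau (y' * star y') = 0 := by
    rw [← tau_mul_eq_mul_tau hΘ hAinv hCinv hfA hcomm hEA (mul_mem (star_mem hxm) hxm)
      (mul_mem hym (star_mem hym)), mul_assoc, ← mul_assoc x', h0, zero_mul, mul_zero, tau,
      Matrix.trace_zero, zero_div]
  rcases mul_eq_zero.1 h4 with h | h
  · left
    rw [tau, div_eq_zero_iff, or_iff_left hN] at h
    exact map_eq_self_of_oddPart_eq_zero (Matrix.trace_conjTranspose_mul_self_eq_zero_iff.1 h)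
  · right
    rw [tau, div_eq_zero_iff, or_iff_left hN] at h
    exact map_eq_self_of_oddPart_eq_zero (Matrix.trace_mul_conjTranspose_self_eq_zero_iff.1 h)

theorem tau_mul_mul_mul_of_even [NeZero N] (hΘ : IsGrading Θ) (hAinv : ThetaInvariant Θ SA)
    (hCinv : ThetaInvariant Θ SC) (hfA : IsFactorSub SA) (hcomm : GradedComm Θ SA SC)
    {EA : Mat N →ₗ[ℂ] Mat N} (hEA : IsCondExp SA EA) {a c : Mat N} (ha : a ∈ SA) (hc : c ∈ SC)
    (h : Θ a = a ∨ Θ c = c) {x y : Mat N} (hx : x ∈ SA) (hy : y ∈ SC) :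
    tau (a * c * (x * y)) = tau (a * x) * tau (c * y) := by
  rcases h with h | h
  · have h1 : tau (c * y) = tau (y * c) := by rw [tau, tau, Matrix.trace_mul_comm]
    rw [(hcomm a ha c hc).1 (Or.inl h), h1, ← tau_mul_eq_mul_tau hΘ hAinv hCinv hfA hcomm hEA
      (mul_mem ha hx) (mul_mem hy hc), tau, tau, mul_assoc c, Matrix.trace_mul_comm]
    simp only [mul_assoc]
  · rw [← tau_mul_eq_mul_tau hΘ hAinv hCinv hfA hcomm hEA (mul_mem ha hx) (mul_mem hc hy),
      mul_assoc, mul_assoc, ← mul_assoc c, ← (hcomm x hx c hc).1 (Or.inr h), mul_assoc]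

/-- One of the marginals of a product state is even. -/
theorem map_eq_self_or_of_product [NeZero N] (hΘ : IsGrading Θ) (hAinv : ThetaInvariant Θ SA)
    (hCinv : ThetaInvariant Θ SC) (hcomm : GradedComm Θ SA SC)
    {EA EC : Mat N →ₗ[ℂ] Mat N} (hEA : IsCondExp SA EA) (hEC : IsCondExp SC EC) {ρ : Mat N}
    (hρ : ρ.IsHermitian)
    (h : ∀ x ∈ SA, ∀ y ∈ SC, tau (ρ * (x * y)) = tau (ρ * x) * tau (ρ * y)) :
    Θ (EA ρ) = EA ρ ∨ Θ (EC ρ) = EC ρ := by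
  have hN : (N : ℂ) ≠ 0 := NeZero.ne _
  have hstar : ∀ z : Mat N, tau (ρ * star z) = star (tau (ρ * z)) := by
    intro z
    rw [tau, tau, star_div₀, ← Matrix.trace_conjTranspose, Matrix.conjTranspose_mul, hρ,
      Matrix.trace_mul_comm, Matrix.star_eq_conjTranspose]
    simp
  set x := star (oddPart Θ (EA ρ)) with hxdef
  set y := star (oddPart Θ (EC ρ)) with hydef
  have hx : x ∈ SA := star_mem (hAinv.oddPart_mem (hEA.1 ρ))
  have hy : y ∈ SC := star_mem (hCinv.oddPart_mem (hEC.1 ρ))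
  have hxo : Θ x = -x := by rw [hxdef, map_star, map_oddPart hΘ, star_neg]
  have hyo : Θ y = -y := by rw [hydef, map_star, map_oddPart hΘ, star_neg]
  have hyx : tau (ρ * (y * x)) = tau (ρ * x) * tau (ρ * y) := by
    have h1 := h _ (star_mem hx) _ (star_mem hy)
    rw [← star_mul, hstar (y * x), hstar x, hstar y, ← star_mul', star_inj] at h1
    exact h1
  have hanti : tau (ρ * (y * x)) = -tau (ρ * (x * y)) := by
    rw [eq_neg_of_add_eq_zero_right ((hcomm x hx y hy).2 hxo hyo), mul_neg, tau, tau,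
      Matrix.trace_neg, neg_div]
  rw [hyx, h x hx y hy, self_eq_neg, hEA.tau_mul ρ hx, hEC.tau_mul ρ hy] at hanti
  rcases mul_eq_zero.1 hanti with h | h
  · left
    rw [tau, div_eq_zero_iff, or_iff_left hN, trace_mul_star_oddPart hΘ] at h
    exact map_eq_self_of_oddPart_eq_zero (Matrix.trace_mul_conjTranspose_self_eq_zero_iff.1 h)
  · right
    rw [tau, div_eq_zero_iff, or_iff_left hN, trace_mul_star_oddPart hΘ] at h
    exact map_eq_self_of_oddPart_eq_zero (Matrix.trace_mul_conjTranspose_self_eq_zero_iff.1 h)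

end GradedPair

theorem msqrt_mul_msqrt_s19 {x : Mat N} (hx : x.PosSemidef) : msqrt x * msqrt x = x := by
  rw [msqrt, hx.1.cfc_mul_cfc, hx.1.cfc_eq_conj_diagonal]
  simp only [Real.mul_self_sqrt (hx.eigenvalues_nonneg _)]
  exact hx.1.eq_conj_diagonal.symm

theorem isSelfAdjoint_msqrt (x : Mat N) : IsSelfAdjoint (msqrt x) :=
  IsSelfAdjoint.cfc

open scoped Matrix.Norms.L2Operator in
/-- If the two symmetrized products of `a` and `c` agree, then `a` and `c` commute. -/
theorem mul_comm_of_msqrt_mul_mul_msqrt_eq {a c : Mat N} (ha : a.PosSemidef) (hc : c.PosSemidef)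
    (h : msqrt c * a * msqrt c = msqrt a * c * msqrt a) : a * c = c * a := by
  set p := msqrt a with hp
  set q := msqrt c with hq
  have hpp : p * p = a := msqrt_mul_msqrt_s19 ha
  have hqq : q * q = c := msqrt_mul_msqrt_s19 hc
  have hps : star p = p := isSelfAdjoint_msqrt a
  have hqs : star q = q := isSelfAdjoint_msqrt c
  have hstar : star (p * q) = q * p := by rw [star_mul, hps, hqs]
  have hnormal : IsStarNormal (p * q) := ⟨by
    rw [hstar, commute_iff_eq]
    calc q * p * (p * q) = q * (p * p) * q := by simp only [mul_assoc]
      _ = p * (q * q) * p := by rw [hpp, hqq, h]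
      _ = p * q * (q * p) := by simp only [mul_assoc]⟩
  have hsemi : SemiconjBy q (p * q) (star (p * q)) := by
    rw [hstar, SemiconjBy, mul_assoc]
  have hcp : c * p = p * c := by
    have h1 := SemiconjBy.star_right hnormal hnormal.star hsemi
    rw [SemiconjBy, star_star, hstar, ← mul_assoc, mul_assoc p, hqq] at h1
    exact h1
  rw [← hpp, mul_assoc, ← hcp, ← mul_assoc, ← hcp, mul_assoc]

/-- Additivity of the entropy in terms of matrix traces. -/
theorem Sres_sub_sub_eq_zero_iff {kA kC : ℕ} (hkA : 0 < kA) (hkC : 0 < kC) (hN : N = kA * kC)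
    (ρ a c : Mat N) :
    Sres ρ N - Sres a kA - Sres c kC = 0 ↔ (ρ * cfc Real.log ρ).trace.re =
      (a * cfc Real.log a).trace.re + (c * cfc Real.log c).trace.re := by
  have hNpos : (0 : ℝ) < N := by rw [hN]; exact_mod_cast Nat.mul_pos hkA hkC
  have hlog : Real.log N = Real.log kA + Real.log kC := by
    rw [hN, Nat.cast_mul, Real.log_mul (by positivity) (by positivity)]
  have hre : ∀ x : Mat N, (tau x).re = x.trace.re / N := fun x => by
    rw [tau, Complex.div_natCast_re]
  simp only [Sres, Shat, mlog, hre, hlog]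
  field_simp
  constructor <;> intro h <;> linarith
/-- for a two-composed graded system `(S_A, S_C)` and a state `ψ_AC`
(τ-density `ρ`): (i) if the marginal densities `ρ_A ∈ S_A`, `ρ_C ∈ S_C` are faithful and
`ρ = ρ_C^{1/2} ρ_A ρ_C^{1/2} = ρ_A^{1/2} ρ_C ρ_A^{1/2}`, then at least one of `ρ_A`, `ρ_C`
is even; (ii) `ψ_AC` satisfies the additivity of von Neumann entropy
`S(ψ_AC) − S(ψ_A) − S(ψ_C) = 0` iff it is a product state for `(S_A, S_C)`, and in that
case at least one of the marginals is even. -/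
theorem stmt19 {N kA kC : ℕ} (hkA : 0 < kA) (hkC : 0 < kC) (hN : N = kA * kC)
    (Θ : Mat N ≃⋆ₐ[ℂ] Mat N) (hΘ : IsGrading Θ)
    (SA SC : StarSubalgebra ℂ (Mat N))
    (hAinv : ThetaInvariant Θ SA) (hCinv : ThetaInvariant Θ SC)
    (hfA : IsFactorSub SA) (hfC : IsFactorSub SC)
    (hcomm : GradedComm Θ SA SC) (hgen : SA ⊔ SC = ⊤)
    (vA : Mat N) (hvA : vA ∈ SA) (hvAe : Θ vA = vA)
    (hvAu : star vA * vA = 1 ∧ vA * star vA = 1)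
    (hvAim : ∀ x ∈ SA, star vA * x * vA = Θ x)
    (EA EC : Mat N →ₗ[ℂ] Mat N) (hEA : IsCondExp SA EA) (hEC : IsCondExp SC EC)
    (hszA : HasMatSize SA kA) (hszC : HasMatSize SC kC)
    (ρ : Mat N) (hρ : IsTauDensity ρ) :
    (∀ ρA ρC : Mat N, ρA ∈ SA → ρC ∈ SC → ρA.PosDef → ρC.PosDef →
        EA ρ = ρA → EC ρ = ρC →
        ρ = msqrt ρC * ρA * msqrt ρC → ρ = msqrt ρA * ρC * msqrt ρA →
        Θ ρA = ρA ∨ Θ ρC = ρC) ∧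
      (Sres ρ N - Sres (EA ρ) kA - Sres (EC ρ) kC = 0 ↔
        ∀ x ∈ SA, ∀ y ∈ SC, tau (ρ * (x * y)) = tau (ρ * x) * tau (ρ * y)) ∧
      (Sres ρ N - Sres (EA ρ) kA - Sres (EC ρ) kC = 0 →
        Θ (EA ρ) = EA ρ ∨ Θ (EC ρ) = EC ρ) := by
  have hNpos : 0 < N := hN ▸ Nat.mul_pos hkA hkC
  have : NeZero N := ⟨hNpos.ne'⟩
  have hN0 : (N : ℂ) ≠ 0 := NeZero.ne _
  have hEAm := hEA.1 ρ
  have hECm := hEC.1 ρ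
  have hpA := hEA.posSemidef hρ.1
  have hpC := hEC.posSemidef hρ.1
  have hmul : ∀ x ∈ SA, ∀ y ∈ SC, tau (x * y) = tau x * tau y := fun x hx y hy =>
    tau_mul_eq_mul_tau hΘ hAinv hCinv hfA hcomm hEA hx hy
  have hAC : ∀ f : ℝ → ℝ, (EA ρ * cfc f (EC ρ)).trace = (cfc f (EC ρ)).trace := fun f => by
    have h := hmul _ hEAm _ (StarSubalgebra.cfc_mem_of_mem hECm f)
    rw [hEA.tau_apply, hρ.2, one_mul, tau, tau, div_left_inj' hN0] at h
    exact h
  have hρC : ∀ f : ℝ → ℝ, (ρ * cfc f (EC ρ)).trace = (EC ρ * cfc f (EC ρ)).trace := fun f =>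
    hEC.trace_mul ρ (StarSubalgebra.cfc_mem_of_mem hECm f)
  have hρA : ∀ f : ℝ → ℝ, (ρ * cfc f (EA ρ)).trace = (EA ρ * cfc f (EA ρ)).trace := fun f =>
    hEA.trace_mul ρ (StarSubalgebra.cfc_mem_of_mem hEAm f)
  have hadd : Sres ρ N - Sres (EA ρ) kA - Sres (EC ρ) kC = 0 →
      ρ = EA ρ * EC ρ ∧ (Θ (EA ρ) = EA ρ ∨ Θ (EC ρ) = EC ρ) := fun h => by
    have hprod := Matrix.eq_mul_of_trace_mul_cfc_log_eq hρ.1 hpA hpC hAC hρC hρA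
      ((Sres_sub_sub_eq_zero_iff hkA hkC hN _ _ _).1 h)
    have hcomm' : EA ρ * EC ρ = EC ρ * EA ρ := by
      have h1 := congrArg Matrix.conjTranspose hprod
      rw [Matrix.conjTranspose_mul, hρ.1.1, hpA.1, hpC.1] at h1
      exact hprod.symm.trans h1
    exact ⟨hprod, map_eq_self_or_of_commute hΘ hAinv hCinv hfA hcomm hEA hEAm hECm hcomm'⟩
  have heven : (Θ (EA ρ) = EA ρ ∨ Θ (EC ρ) = EC ρ) → ∀ x ∈ SA, ∀ y ∈ SC,
      tau (EA ρ * EC ρ * (x * y)) = tau (ρ * x) * tau (ρ * y) := fun h x hx y hy => by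
    rw [hEA.tau_mul ρ hx, hEC.tau_mul ρ hy]
    exact tau_mul_mul_mul_of_even hΘ hAinv hCinv hfA hcomm hEA hEAm hECm h hx hy
  refine ⟨?_, ⟨fun h x hx y hy => ?_, fun h => ?_⟩, fun h => (hadd h).2⟩
  · intro ρA ρC hA hC hAp hCp _ _ h1 h2
    exact map_eq_self_or_of_commute hΘ hAinv hCinv hfA hcomm hEA hA hC
      (mul_comm_of_msqrt_mul_mul_msqrt_eq hAp.posSemidef hCp.posSemidef (h1.symm.trans h2))
  · obtain ⟨hprod, he⟩ := hadd h
    rw [← heven he x hx y hy, ← hprod]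
  · have he := map_eq_self_or_of_product hΘ hAinv hCinv hcomm hEA hEC hρ.1.1 h
    have hprod : ρ = EA ρ * EC ρ :=
      eq_of_forall_trace_mul_mul_eq hΘ hAinv hCinv hcomm hgen fun x hx y hy => by
        have h1 := (h x hx y hy).trans (heven he x hx y hy).symm
        rw [tau, tau, div_left_inj' hN0] at h1
        exact h1
    exact (Sres_sub_sub_eq_zero_iff hkA hkC hN _ _ _).2
      (Matrix.trace_mul_cfc_log_eq_of_eq_mul hρ.1 hpA hpC hAC hρC hρA
        ((hcomm _ hEAm _ hECm).1 he) hprod)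
end
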